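/- Let u₀ : [0,1] → S² ⊂ ℝ³ be a smooth map satisfying the compatibility condition C̃C(k) for every k ≥ 0. Then there exists a unique global smooth map u : [0,1] × [0,∞) → ℝ³ with |u(x,t)| = 1 everywhere, satisfying ∂_t u = u × ∂_x²u on [0,1] × [0,∞), the Neumann boundary conditions ∂_x u(0,t) = ∂_x u(1,t) = 0 for all t ≥ 0, and u(·,0) = u₀. -/

import Mathlib

open MeasureTheory Set

noncomputable section

abbrev E3 := EuclideanSpace ℝ (Fin 3)

/-- The cross product on `EuclideanSpace ℝ (Fin 3)`. -/
def cross3 (a b : E3) : E3 :=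
  (WithLp.equiv 2 (Fin 3 → ℝ)).symm
    (crossProduct ((WithLp.equiv 2 (Fin 3 → ℝ)) a) ((WithLp.equiv 2 (Fin 3 → ℝ)) b))

/-- Partial derivative in the space variable of `u = u x t`. -/
def pdx (u : ℝ → ℝ → E3) : ℝ → ℝ → E3 := fun x t => deriv (fun y => u y t) x

/-- Partial derivative in the time variable of `u = u x t`. -/
def pdt (u : ℝ → ℝ → E3) : ℝ → ℝ → E3 := fun x t => deriv (fun s => u x s) t

/-- `u` is a smooth solution of the 1-dimensional Schrödinger flow with Neumann
boundary conditions on `[0,1] × [0,T]`. -/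
def IsSol (T : ℝ) (u : ℝ → ℝ → E3) : Prop :=
  ContDiff ℝ (⊤ : ℕ∞) (fun p : ℝ × ℝ => u p.1 p.2) ∧
  (∀ x ∈ Icc (0:ℝ) 1, ∀ t ∈ Icc (0:ℝ) T, ‖u x t‖ = 1) ∧
  (∀ x ∈ Icc (0:ℝ) 1, ∀ t ∈ Icc (0:ℝ) T, pdt u x t = cross3 (u x t) (pdx (pdx u) x t)) ∧
  (∀ t ∈ Icc (0:ℝ) T, pdx u 0 t = 0 ∧ pdx u 1 t = 0)

/-- Squared `L²` norm on `[0,1]`. -/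
def L2sq (f : ℝ → E3) : ℝ := ∫ x in (0:ℝ)..1, ‖f x‖ ^ 2

/-- Squared `H^k` Sobolev norm on `[0,1]`. -/
def Hsq (k : ℕ) (f : ℝ → E3) : ℝ :=
  ∑ j ∈ Finset.range (k + 1), ∫ x in (0:ℝ)..1, ‖deriv^[j] f x‖ ^ 2

/-- `u` is a global smooth solution of the 1-dimensional Schrödinger flow with Neumann
boundary conditions on `[0,1] × [0,∞)`. -/
def IsGlobalSol (u : ℝ → ℝ → E3) : Prop :=
  ContDiff ℝ (⊤ : ℕ∞) (fun p : ℝ × ℝ => u p.1 p.2) ∧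
  (∀ x ∈ Icc (0:ℝ) 1, ∀ t ∈ Ici (0:ℝ), ‖u x t‖ = 1) ∧
  (∀ x ∈ Icc (0:ℝ) 1, ∀ t ∈ Ici (0:ℝ), pdt u x t = cross3 (u x t) (pdx (pdx u) x t)) ∧
  (∀ t ∈ Ici (0:ℝ), pdx u 0 t = 0 ∧ pdx u 1 t = 0)

/-- Covariant derivative along `u₀` of a vector field `V`. -/
def covD (u₀ V : ℝ → E3) : ℝ → E3 :=
  fun x => deriv V x - (inner ℝ (deriv V x) (u₀ x) : ℝ) • u₀ x

/-- `covIter u₀ j = ∇̃ₓ^(j+1) u₀`: iterated covariant derivatives of `u₀`. -/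
def covIter (u₀ : ℝ → E3) : ℕ → ℝ → E3
  | 0 => fun x => deriv u₀ x
  | (j+1) => covD u₀ (covIter u₀ j)

/-- The compatibility condition `C̃C(k)`: `∇̃ₓ^(2j+1) u₀` vanishes at both endpoints
for all `0 ≤ j ≤ k`. -/
def CC (u₀ : ℝ → E3) (k : ℕ) : Prop :=
  ∀ j ≤ k, covIter u₀ (2 * j) 0 = 0 ∧ covIter u₀ (2 * j) 1 = 0

/-! ### Ordinary differential equations -/

section ODE

open Metric Filter Topology
open scoped NNReal

variable {E : Type*} [NormedAddCommGroup E] [NormedSpace ℝ E]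

/-- A two-sided form of Grönwall's inequality. -/
theorem norm_le_gronwallBound_abs {f f' : ℝ → E} {K ε T : ℝ}
    (hf : ∀ t, |t| ≤ T → HasDerivAt f (f' t) t)
    (hb : ∀ t, |t| ≤ T → ‖f' t‖ ≤ K * ‖f t‖ + ε) {t : ℝ} (ht : |t| ≤ T) :
    ‖f t‖ ≤ gronwallBound ‖f 0‖ K ε |t| := by
  have key : ∀ (g g' : ℝ → E), (∀ s, |s| ≤ T → HasDerivAt g (g' s) s) →
      (∀ s, |s| ≤ T → ‖g' s‖ ≤ K * ‖g s‖ + ε) → ‖g |t|‖ ≤ gronwallBound ‖g 0‖ K ε |t| := by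
    intro g g' hg hgb
    have hs : ∀ s ∈ Icc 0 |t|, |s| ≤ T := fun s hs => by
      rw [abs_of_nonneg hs.1]; exact hs.2.trans ht
    have := norm_le_gronwallBound_of_norm_deriv_right_le (f := g) (f' := g') (δ := ‖g 0‖) (K := K)
      (ε := ε) (a := 0) (b := |t|)
      (fun s h => (hg s (hs s h)).continuousAt.continuousWithinAt)
      (fun s h => (hg s (hs s (Ico_subset_Icc_self h))).hasDerivWithinAt) le_rfl
      (fun s h => hgb s (hs s (Ico_subset_Icc_self h))) |t| ⟨abs_nonneg _, le_rfl⟩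
    simpa using this
  rcases le_total 0 t with h | h
  · simpa [abs_of_nonneg h] using key f f' hf hb
  · have := key (fun s => f (-s)) (fun s => -f' (-s)) (fun s hs => by
      have := (hf (-s) (by simpa using hs)).scomp s (hasDerivAt_neg s)
      simpa [Function.comp_def] using this) (fun s hs => by
      simpa using hb (-s) (by simpa using hs))
    simpa [abs_of_nonpos h] using this

/-- `f` is Lipschitz on bounded sets, locally uniformly in time. -/
def LocLip (f : ℝ → E → E) : Prop :=
  ∀ T R : ℝ, ∃ K : ℝ≥0, ∀ t, |t| ≤ T → LipschitzOnWith K (f t) (closedBall 0 R)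

/-- Local existence with a lifespan that is uniform on bounded sets. -/
theorem LocLip.exists_uniform_time [CompleteSpace E] {f : ℝ → E → E} (hL : LocLip f)
    (hc : ∀ x, Continuous fun t => f t x) (T R : ℝ) :
    ∃ δ > 0, ∀ t₀, |t₀| ≤ T → ∀ x, ‖x‖ ≤ R → ∃ α : ℝ → E, α t₀ = x ∧
      ∀ t ∈ Ioo (t₀ - δ) (t₀ + δ), HasDerivAt α (f t (α t)) t := by
  obtain ⟨K, hK⟩ := hL (T + 1) (|R| + 1)
  obtain ⟨M, hM⟩ := isCompact_Icc.exists_bound_of_continuousOn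
    (s := Icc (-(T + 1)) (T + 1)) (hc 0).continuousOn
  set L : ℝ≥0 := ⟨|M| + K * (|R| + 1), by positivity⟩ with hLdef
  set δ : ℝ := min 1 (1 / (L + 1)) with hδ
  have hδ0 : 0 < δ := by positivity
  refine ⟨δ, hδ0, fun t₀ ht₀ x hx => ?_⟩
  have htime : ∀ t ∈ Icc (t₀ - δ) (t₀ + δ), |t| ≤ T + 1 := by
    intro t ht
    have h1 : |t - t₀| ≤ δ := by rw [abs_le]; constructor <;> linarith [ht.1, ht.2]
    have h2 : δ ≤ 1 := min_le_left _ _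
    calc |t| = |(t - t₀) + t₀| := by ring_nf
      _ ≤ |t - t₀| + |t₀| := abs_add_le _ _
      _ ≤ T + 1 := by linarith
  have hball : closedBall x ((1 : ℝ≥0) : ℝ) ⊆ closedBall 0 (|R| + 1) := by
    intro y hy
    rw [mem_closedBall, dist_eq_norm] at *
    simp only [sub_zero, NNReal.coe_one] at *
    calc ‖y‖ = ‖(y - x) + x‖ := by abel_nf
      _ ≤ ‖y - x‖ + ‖x‖ := norm_add_le _ _
      _ ≤ |R| + 1 := by linarith [le_abs_self R]
  have hPL : IsPicardLindelof f (tmin := t₀ - δ) (tmax := t₀ + δ) ⟨t₀, by constructor <;> linarith⟩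
      x 1 0 L K := by
    refine ⟨fun t ht => (hK t (htime t ht)).mono hball, fun y _ => (hc y).continuousOn,
      fun t ht y hy => ?_, ?_⟩
    · have h1 := (hK t (htime t ht)).dist_le_mul y (hball hy) 0 (by simp; positivity)
      have h2 : ‖f t 0‖ ≤ M := hM t (abs_le.1 (htime t ht))
      have h3 : ‖y‖ ≤ |R| + 1 := by simpa using hball hy
      rw [dist_eq_norm, dist_zero_right] at h1
      have h4 : (K : ℝ) * ‖y‖ ≤ K * (|R| + 1) := by gcongr
      calc ‖f t y‖ = ‖(f t y - f t 0) + f t 0‖ := by abel_nf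
        _ ≤ ‖f t y - f t 0‖ + ‖f t 0‖ := norm_add_le _ _
        _ ≤ |M| + K * (|R| + 1) := by linarith [le_abs_self M]
    · have : (L : ℝ) * δ ≤ 1 := by
        calc (L : ℝ) * δ ≤ (L + 1) * (1 / (L + 1)) := by
              gcongr
              · linarith
              · exact min_le_right _ _
          _ = 1 := by field_simp
      simpa using this
  obtain ⟨α, hα0, hα⟩ := hPL.exists_eq_forall_mem_Icc_hasDerivWithinAt₀
  exact ⟨α, hα0, fun t ht => (hα t (Ioo_subset_Icc_self ht)).hasDerivAt (Icc_mem_nhds ht.1 ht.2)⟩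

/-- Uniqueness on open intervals for locally Lipschitz vector fields. -/
theorem LocLip.eqOn {f : ℝ → E → E} (hL : LocLip f) {a b t₀ : ℝ} (ht₀ : t₀ ∈ Ioo a b)
    {y z : ℝ → E} (hy : ∀ t ∈ Ioo a b, HasDerivAt y (f t (y t)) t)
    (hz : ∀ t ∈ Ioo a b, HasDerivAt z (f t (z t)) t) (h0 : y t₀ = z t₀) :
    EqOn y z (Ioo a b) := by
  intro t ht
  obtain ⟨a', ha', ha''⟩ := exists_between (lt_min ht.1 ht₀.1)
  obtain ⟨b', hb', hb''⟩ := exists_between (max_lt ht.2 ht₀.2)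
  have hsub : Icc a' b' ⊆ Ioo a b := fun s hs => ⟨ha'.trans_le hs.1, hs.2.trans_lt hb''⟩
  obtain ⟨B₁, hB₁⟩ := isCompact_Icc.exists_bound_of_continuousOn (s := Icc a' b') (f := y)
    (fun s hs => (hy s (hsub hs)).continuousAt.continuousWithinAt)
  obtain ⟨B₂, hB₂⟩ := isCompact_Icc.exists_bound_of_continuousOn (s := Icc a' b') (f := z)
    (fun s hs => (hz s (hsub hs)).continuousAt.continuousWithinAt)
  obtain ⟨K, hK⟩ := hL (max |a'| |b'|) (max B₁ B₂)
  have hI : Ioo a' b' ⊆ Icc a' b' := Ioo_subset_Icc_self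
  refine ODE_solution_unique_of_mem_Ioo (v := f) (s := fun _ => closedBall 0 (max B₁ B₂))
    (a := a') (b := b') (K := K) (t₀ := t₀) (fun s hs => hK s ?_)
    ⟨(lt_min_iff.1 ha'').2, (max_lt_iff.1 hb').2⟩
    (fun s hs => ⟨hy s (hsub (hI hs)), ?_⟩) (fun s hs => ⟨hz s (hsub (hI hs)), ?_⟩) h0
    ⟨(lt_min_iff.1 ha'').1, (max_lt_iff.1 hb').1⟩
  · exact abs_le_max_abs_abs hs.1.le hs.2.le
  · simpa using Or.inl (hB₁ s (hI hs))
  · simpa using Or.inr (hB₂ s (hI hs))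

/-- Continuation of a bounded solution by a fixed amount of time on both sides. -/
theorem LocLip.extend {f : ℝ → E → E} (hL : LocLip f) {δ τ : ℝ} (hδ : 0 < δ) (hτ : δ ≤ τ)
    {y : ℝ → E} (hy : ∀ t ∈ Ioo (-τ) τ, HasDerivAt y (f t (y t)) t)
    (hloc : ∀ t₀ ∈ Ioo (-τ) τ, ∃ α : ℝ → E, α t₀ = y t₀ ∧
      ∀ t ∈ Ioo (t₀ - δ) (t₀ + δ), HasDerivAt α (f t (α t)) t) :
    ∃ z : ℝ → E, z 0 = y 0 ∧ ∀ t ∈ Ioo (-(τ + δ / 2)) (τ + δ / 2), HasDerivAt z (f t (z t)) t := by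
  obtain ⟨α, hα0, hα⟩ := hloc (τ - δ / 2) ⟨by linarith, by linarith⟩
  obtain ⟨β, hβ0, hβ⟩ := hloc (-(τ - δ / 2)) ⟨by linarith, by linarith⟩
  have eα : EqOn y α (Ioo (τ - δ) τ) := hL.eqOn (t₀ := τ - δ / 2) ⟨by linarith, by linarith⟩
    (fun t ht => hy t ⟨by linarith [ht.1], ht.2⟩)
    (fun t ht => hα t ⟨by linarith [ht.1], by linarith [ht.2]⟩) hα0.symm
  have eβ : EqOn y β (Ioo (-τ) (-(τ - δ))) := hL.eqOn (t₀ := -(τ - δ / 2))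
    ⟨by linarith, by linarith⟩
    (fun t ht => hy t ⟨ht.1, by linarith [ht.2]⟩)
    (fun t ht => hβ t ⟨by linarith [ht.1], by linarith [ht.2]⟩) hβ0.symm
  classical
  set z : ℝ → E := fun t => if |t| < τ then y t else if 0 < t then α t else β t with hz
  have zy : ∀ t, |t| < τ → z t = y t := fun t ht => if_pos ht
  have zα : ∀ t, τ - δ < t → z t = α t := by
    intro t ht
    by_cases h : |t| < τ
    · rw [zy t h]; exact eα ⟨ht, (abs_lt.1 h).2⟩
    · simp only [hz, if_neg h, if_pos (show 0 < t by linarith)]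
  have zβ : ∀ t, t < -(τ - δ) → z t = β t := by
    intro t ht
    by_cases h : |t| < τ
    · rw [zy t h]; exact eβ ⟨(abs_lt.1 h).1, ht⟩
    · simp only [hz, if_neg h, if_neg (show ¬ 0 < t by linarith)]
  refine ⟨z, zy 0 (by simp; linarith), fun t ht => ?_⟩
  by_cases h : |t| < τ
  · rw [zy t h]
    refine (hy t (abs_lt.1 h)).congr_of_eventuallyEq ?_
    filter_upwards [continuous_abs.continuousAt.eventually_lt_const h] with s hs using zy s hs
  · rcases le_total 0 t with h0 | h0
    · rw [abs_of_nonneg h0, not_lt] at h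
      rw [zα t (by linarith)]
      refine (hα t ⟨by linarith, by linarith [ht.2]⟩).congr_of_eventuallyEq ?_
      filter_upwards [lt_mem_nhds (show τ - δ < t by linarith)] with s hs using zα s hs
    · rw [abs_of_nonpos h0, not_lt] at h
      rw [zβ t (by linarith)]
      refine (hβ t ⟨by linarith [ht.1], by linarith⟩).congr_of_eventuallyEq ?_
      filter_upwards [gt_mem_nhds (show t < -(τ - δ) by linarith)] with s hs using zβ s hs

/-- Global existence for locally Lipschitz vector fields under an a priori bound. -/
theorem LocLip.exists_global [CompleteSpace E] {f : ℝ → E → E} (hL : LocLip f)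
    (hc : ∀ x, Continuous fun t => f t x) (x₀ : E)
    (hB : ∀ T : ℝ, ∃ B : ℝ, ∀ τ, 0 < τ → τ ≤ T → ∀ y : ℝ → E, y 0 = x₀ →
      (∀ t ∈ Ioo (-τ) τ, HasDerivAt y (f t (y t)) t) → ∀ t ∈ Ioo (-τ) τ, ‖y t‖ ≤ B) :
    ∃ y : ℝ → E, y 0 = x₀ ∧ ∀ t, HasDerivAt y (f t (y t)) t := by
  have hloc : ∀ T > 0, ∃ y : ℝ → E, y 0 = x₀ ∧ ∀ t ∈ Ioo (-T) T, HasDerivAt y (f t (y t)) t := by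
    intro T hT
    obtain ⟨B, hB⟩ := hB T
    obtain ⟨δ', hδ', hex'⟩ := hL.exists_uniform_time hc T (max B ‖x₀‖)
    set δ := min δ' T with hδdef
    have hδ : 0 < δ := lt_min hδ' hT
    have hex : ∀ t₀, |t₀| ≤ T → ∀ x, ‖x‖ ≤ max B ‖x₀‖ → ∃ α : ℝ → E, α t₀ = x ∧
        ∀ t ∈ Ioo (t₀ - δ) (t₀ + δ), HasDerivAt α (f t (α t)) t := by
      intro t₀ ht₀ x hx
      obtain ⟨α, h0, h1⟩ := hex' t₀ ht₀ x hx
      have := min_le_left δ' T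
      exact ⟨α, h0, fun t ht => h1 t ⟨by linarith [ht.1], by linarith [ht.2]⟩⟩
    have hn : ∀ n : ℕ, ∃ y : ℝ → E, y 0 = x₀ ∧ ∀ t ∈ Ioo (-(min T (δ + n * (δ / 2))))
        (min T (δ + n * (δ / 2))), HasDerivAt y (f t (y t)) t := by
      intro n
      induction n with
      | zero =>
        obtain ⟨α, h0, h1⟩ := hex 0 (by simpa using hT.le) x₀ (le_max_right _ _)
        refine ⟨α, h0, fun t ht => h1 t ?_⟩
        have : min T (δ + (0 : ℕ) * (δ / 2)) ≤ δ := by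
          refine (min_le_right _ _).trans (by simp)
        exact ⟨by linarith [ht.1], by linarith [ht.2]⟩
      | succ n ih =>
        obtain ⟨y, hy0, hy⟩ := ih
        set τ := min T (δ + n * (δ / 2)) with hτ
        have hδτ : δ ≤ τ := le_min (min_le_right _ _) (by
          have : (0:ℝ) ≤ n * (δ / 2) := by positivity
          linarith)
        have hτT : τ ≤ T := min_le_left _ _
        have hyB := hB τ (hδ.trans_le hδτ) hτT y hy0 hy
        obtain ⟨z, hz0, hz⟩ := hL.extend hδ hδτ hy (fun t₀ ht₀ =>
          hex t₀ ((abs_lt.2 ht₀).le.trans hτT) (y t₀) ((hyB t₀ ht₀).trans (le_max_left _ _)))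
        have hle : min T (δ + (n + 1 : ℕ) * (δ / 2)) ≤ τ + δ / 2 := by
          push_cast
          rcases min_choice T (δ + n * (δ / 2)) with h | h <;> rw [← hτ] at h
          · linarith [min_le_left T (δ + (n + 1 : ℝ) * (δ / 2))]
          · linarith [min_le_right T (δ + (n + 1 : ℝ) * (δ / 2))]
        exact ⟨z, hz0.trans hy0, fun t ht => hz t ⟨by linarith [ht.1], by linarith [ht.2]⟩⟩
    obtain ⟨n, hn'⟩ := exists_nat_gt (T / (δ / 2))
    obtain ⟨y, hy0, hy⟩ := hn n
    rw [div_lt_iff₀ (by positivity)] at hn'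
    rw [min_eq_left (by linarith)] at hy
    exact ⟨y, hy0, hy⟩
  choose Y hY0 hY using fun n : ℕ => hloc (n + 1) (by positivity)
  have hcompat : ∀ m n : ℕ, m ≤ n → ∀ t : ℝ, |t| < m + 1 → Y m t = Y n t := by
    intro m n hmn t ht
    have hmn' : (m : ℝ) ≤ n := by exact_mod_cast hmn
    refine hL.eqOn (a := -(m + 1)) (b := m + 1) (t₀ := 0)
      (by constructor <;> linarith [(Nat.cast_nonneg m : (0:ℝ) ≤ m)]) (hY m)
      (fun s hs => hY n s ⟨by linarith [hs.1], by linarith [hs.2]⟩) (by rw [hY0, hY0]) (abs_lt.1 ht)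
  set y : ℝ → E := fun t => Y ⌊|t|⌋₊ t with hy
  have hyY : ∀ (N : ℕ) (s : ℝ), |s| < N + 1 → y s = Y N s := by
    intro N s hs
    refine hcompat _ _ ?_ s (Nat.lt_floor_add_one _)
    exact Nat.lt_succ_iff.1 ((Nat.floor_lt (abs_nonneg s)).2 (by exact_mod_cast hs))
  refine ⟨y, by rw [hyY 0 0 (by simp), hY0], fun t => ?_⟩
  have ht := Nat.lt_floor_add_one |t|
  rw [hyY _ t ht]
  refine (hY ⌊|t|⌋₊ t (abs_lt.1 ht)).congr_of_eventuallyEq ?_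
  filter_upwards [continuous_abs.continuousAt.eventually_lt_const ht] with s hs using hyY _ s hs

/-- Global existence for linear equations with continuous coefficients. -/
theorem exists_linear_ode [CompleteSpace E] {A : ℝ → E →L[ℝ] E} (hA : Continuous A) (x₀ : E) :
    ∃ y : ℝ → E, y 0 = x₀ ∧ ∀ t, HasDerivAt y (A t (y t)) t := by
  have hbd : ∀ T : ℝ, ∃ K : ℝ≥0, ∀ t, |t| ≤ T → ‖A t‖ ≤ K := by
    intro T
    obtain ⟨M, hM⟩ := isCompact_Icc.exists_bound_of_continuousOn (s := Icc (-T) T) hA.continuousOn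
    exact ⟨M.toNNReal, fun t ht => (hM t (abs_le.1 ht)).trans (Real.le_coe_toNNReal M)⟩
  refine LocLip.exists_global (f := fun t x => A t x) (fun T R => ?_) (fun x => by fun_prop) x₀
    (fun T => ?_)
  · obtain ⟨K, hK⟩ := hbd T
    exact ⟨K, fun t ht => ((A t).lipschitz.weaken (by exact_mod_cast hK t ht)).lipschitzOnWith⟩
  · obtain ⟨K, hK⟩ := hbd T
    refine ⟨gronwallBound ‖x₀‖ K 0 T, fun τ hτ hτT y hy0 hy t ht => ?_⟩
    have htτ : |t| < τ := abs_lt.2 ht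
    have := norm_le_gronwallBound_abs (f := y) (f' := fun s => A s (y s)) (T := |t|) (K := K)
      (ε := 0) (fun s hs => hy s (abs_lt.1 (hs.trans_lt htτ)))
      (fun s hs => by
        have := (A s).le_of_opNorm_le (hK s (by linarith)) (y s)
        simpa using this) le_rfl
    rw [hy0] at this
    exact this.trans (gronwallBound_mono (norm_nonneg _) le_rfl K.2 (by linarith))

end ODE

/-! ### Functions of two real variables and zero curvature systems -/

section ZeroCurvature

open Metric Filter Topology
open scoped NNReal ContDiff

theorem contDiff_succ_of_partials {E : Type*} [NormedAddCommGroup E] [NormedSpace ℝ E]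
    {f fx ft : ℝ × ℝ → E} {n : ℕ}
    (hx : ∀ x t, HasDerivAt (fun y => f (y, t)) (fx (x, t)) x)
    (ht : ∀ x t, HasDerivAt (fun s => f (x, s)) (ft (x, t)) t)
    (hfx : ContDiff ℝ n fx) (hft : ContDiff ℝ n ft) : ContDiff ℝ (n + 1) f := by
  have hd : ∀ p : ℝ × ℝ, HasFDerivAt f
      ((ContinuousLinearMap.toSpanSingleton ℝ (fx p)).coprod
        (ContinuousLinearMap.toSpanSingleton ℝ (ft p))) p := by
    intro p
    have := hasStrictFDerivAt_uncurry_coprod (𝕜 := ℝ) (u := p) (f := fun x t => f (x, t))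
      (f₁ := fun x t => ContinuousLinearMap.toSpanSingleton ℝ (fx (x, t)))
      (f₂ := fun x t => ContinuousLinearMap.toSpanSingleton ℝ (ft (x, t)))
      (Eventually.of_forall fun v => (hx v.1 v.2).hasFDerivAt)
      (Eventually.of_forall fun v => (ht v.1 v.2).hasFDerivAt)
      (((ContinuousLinearMap.toSpanSingletonCLE (𝕜 := ℝ) (E := E)).continuous.comp
        hfx.continuous).continuousAt)
      (((ContinuousLinearMap.toSpanSingletonCLE (𝕜 := ℝ) (E := E)).continuous.comp
        hft.continuous).continuousAt)
    exact this.hasFDerivAt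
  refine contDiff_succ_iff_fderiv.2 ⟨fun p => (hd p).differentiableAt, by simp, ?_⟩
  have : fderiv ℝ f = fun p =>
      (ContinuousLinearMap.toSpanSingletonCLE (𝕜 := ℝ) (E := E) (fx p)).comp
        (ContinuousLinearMap.fst ℝ ℝ ℝ) +
      (ContinuousLinearMap.toSpanSingletonCLE (𝕜 := ℝ) (E := E) (ft p)).comp
        (ContinuousLinearMap.snd ℝ ℝ ℝ) := by
    funext p
    rw [(hd p).fderiv]
    ext <;> simp
  rw [this]
  have e1 := (ContinuousLinearMap.toSpanSingletonCLE (𝕜 := ℝ) (E := E)).contDiff.comp hfx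
  have e2 := (ContinuousLinearMap.toSpanSingletonCLE (𝕜 := ℝ) (E := E)).contDiff.comp hft
  exact (e1.clm_comp contDiff_const).add (e2.clm_comp contDiff_const)

theorem gronwallBound_smul (K C ε X : ℝ) :
    gronwallBound ε K (C * ε) X = ε * gronwallBound 1 K C X := by
  unfold gronwallBound
  split_ifs
  · ring
  · ring

variable {𝔸 : Type*} [NormedRing 𝔸] [NormedAlgebra ℝ 𝔸]

/-- Uniform first order Taylor expansion in the second variable. -/
theorem eventually_taylor_uniform {E : Type*} [NormedAddCommGroup E] [NormedSpace ℝ E]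
    {U Ut : ℝ × ℝ → E} (hUt : ∀ x t, HasDerivAt (fun s => U (x, s)) (Ut (x, t)) t)
    (hc : Continuous Ut) (X t : ℝ) {ε : ℝ} (hε : 0 < ε) :
    ∀ᶠ h : ℝ in 𝓝 0, ∀ x ∈ Icc (-X) X,
      ‖U (x, t + h) - U (x, t) - h • Ut (x, t)‖ ≤ ε * ‖h‖ := by
  have h1 : ∀ᶠ h : ℝ in 𝓝 0, ∀ x ∈ Icc (-X) X, ‖Ut (x, t + h) - Ut (x, t)‖ < ε := by
    refine isCompact_Icc.eventually_forall_of_forall_eventually fun x _ => ?_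
    have hcont : Continuous fun z : ℝ × ℝ => ‖Ut (z.2, t + z.1) - Ut (z.2, t)‖ := by fun_prop
    exact hcont.continuousAt.eventually_lt_const (by simpa using hε)
  obtain ⟨δ, hδ, hball⟩ := Metric.eventually_nhds_iff_ball.1 h1
  filter_upwards [ball_mem_nhds 0 hδ] with h hh x hx
  have hconv : Convex ℝ (ball t δ) := convex_ball _ _
  have := hconv.norm_image_sub_le_of_norm_hasDerivWithin_le
    (f := fun s => U (x, s) - (s - t) • Ut (x, t)) (f' := fun s => Ut (x, s) - Ut (x, t))
    (C := ε) (x := t) (y := t + h)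
    (fun s _ => by
      have e := ((hasDerivAt_id s).sub_const t).smul_const (Ut (x, t))
      simpa [Pi.sub_def] using ((hUt x s).sub e).hasDerivWithinAt)
    (fun s hs => by
      have := hball (s - t) (by simpa [dist_eq_norm] using hs) x hx
      simpa using this.le) (mem_ball_self hδ) (by simpa [dist_eq_norm] using hh)
  simpa [sub_right_comm] using this

/-- A system `F_x = F U`, `F_t = F V` with `U_t - V_x = U V - V U` is solvable. -/
theorem exists_frame_of_zero_curvature [CompleteSpace 𝔸] {U V Vx : ℝ × ℝ → 𝔸}
    (hU : ContDiff ℝ ∞ U) (hV : ContDiff ℝ ∞ V) (hVxc : Continuous Vx)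
    (hVx : ∀ x t, HasDerivAt (fun y => V (y, t)) (Vx (x, t)) x)
    (hUt : ∀ x t, HasDerivAt (fun s => U (x, s))
      (Vx (x, t) + U (x, t) * V (x, t) - V (x, t) * U (x, t)) t) (F₀ : 𝔸) :
    ∃ F : ℝ × ℝ → 𝔸, ContDiff ℝ ∞ F ∧ F (0, 0) = F₀ ∧
      (∀ x t, HasDerivAt (fun y => F (y, t)) (F (x, t) * U (x, t)) x) ∧
      (∀ x t, HasDerivAt (fun s => F (x, s)) (F (x, t) * V (x, t)) t) := by
  have hUc := hU.continuous
  have hVc := hV.continuous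
  obtain ⟨g, hg0, hg⟩ := exists_linear_ode
    (A := fun t => (ContinuousLinearMap.mul ℝ 𝔸).flip (V (0, t))) (by fun_prop) F₀
  choose Φ hΦ0 hΦ using fun t => exists_linear_ode
    (A := fun x => (ContinuousLinearMap.mul ℝ 𝔸).flip (U (x, t))) (by fun_prop) (g t)
  simp only [ContinuousLinearMap.flip_apply, ContinuousLinearMap.mul_apply'] at hg hΦ
  have hgc : Continuous g := continuous_iff_continuousAt.2 fun t => (hg t).continuousAt
  have hΦc : ∀ t, Continuous (Φ t) := fun t =>
    continuous_iff_continuousAt.2 fun x => (hΦ t x).continuousAt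
  -- the derivative in time
  have hFt : ∀ x t, HasDerivAt (fun s => Φ s x) (Φ t x * V (x, t)) t := by
    intro x t
    set X := |x| with hX
    obtain ⟨K, hK⟩ := (isCompact_Icc.prod isCompact_Icc).exists_bound_of_continuousOn
      (s := Icc (-X) X ×ˢ Icc (t - 1) (t + 1)) hUc.continuousOn
    obtain ⟨C₁, hC₁⟩ := isCompact_Icc.exists_bound_of_continuousOn (s := Icc (-X) X)
      (hΦc t).continuousOn
    obtain ⟨C₂, hC₂⟩ := isCompact_Icc.exists_bound_of_continuousOn (s := Icc (-X) X)
      (f := fun y => Φ t y * V (y, t)) (by have := hΦc t; fun_prop)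
    have h0X : (0 : ℝ) ∈ Icc (-X) X := by simp [hX]
    have hC₁0 := (norm_nonneg _).trans (hC₁ 0 h0X)
    have hC₂0 := (norm_nonneg _).trans (hC₂ 0 h0X)
    set G := gronwallBound 1 K (C₁ + C₂) X with hG
    rw [hasDerivAt_iff_isLittleO_nhds_zero, Asymptotics.isLittleO_iff]
    intro c hc
    obtain ⟨ε, hε, hεG⟩ : ∃ ε > 0, ε * G ≤ c := by
      refine ⟨c / (|G| + 1), by positivity, ?_⟩
      rw [div_mul_eq_mul_div, div_le_iff₀ (by positivity)]
      nlinarith [le_abs_self G]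
    have e1 := eventually_taylor_uniform (U := U)
      (Ut := fun p => Vx p + U p * V p - V p * U p) hUt (by fun_prop) X t hε
    have e2 : ∀ᶠ h : ℝ in 𝓝 0, ∀ y ∈ Icc (-X) X, ‖U (y, t + h) - U (y, t)‖ < ε := by
      refine isCompact_Icc.eventually_forall_of_forall_eventually fun y _ => ?_
      have hcont : Continuous fun z : ℝ × ℝ => ‖U (z.2, t + z.1) - U (z.2, t)‖ := by fun_prop
      exact hcont.continuousAt.eventually_lt_const (by simpa using hε)
    have e3 := (Asymptotics.isLittleO_iff.1 (hasDerivAt_iff_isLittleO_nhds_zero.1 (hg t))) hε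
    filter_upwards [e1, e2, e3, closedBall_mem_nhds (0 : ℝ) one_pos] with h h1 h2 h3 h4
    have h4' : |h| ≤ 1 := by simpa using h4
    have key := norm_le_gronwallBound_abs (T := X) (K := K) (ε := (C₁ + C₂) * (ε * ‖h‖))
      (f := fun y => Φ (t + h) y - Φ t y - h • (Φ t y * V (y, t)))
      (f' := fun y => Φ (t + h) y * U (y, t + h) - Φ t y * U (y, t) -
        h • (Φ t y * U (y, t) * V (y, t) + Φ t y * Vx (y, t)))
      (fun y _ => ((hΦ (t + h) y).sub (hΦ t y)).sub (((hΦ t y).mul (hVx y t)).const_smul h))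
      (fun y hy => ?_) (t := x) le_rfl
    · refine key.trans ?_
      have hδ : ‖Φ (t + h) 0 - Φ t 0 - h • (Φ t 0 * V (0, t))‖ ≤ ε * ‖h‖ := by
        simpa [hΦ0] using h3
      have hmono : gronwallBound ‖Φ (t + h) 0 - Φ t 0 - h • (Φ t 0 * V (0, t))‖ K
          ((C₁ + C₂) * (ε * ‖h‖)) X ≤ gronwallBound (ε * ‖h‖) K ((C₁ + C₂) * (ε * ‖h‖)) X := by
        unfold gronwallBound
        split_ifs
        · gcongr
        · gcongr
      refine hmono.trans ?_
      rw [gronwallBound_smul, ← hG, mul_right_comm]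
      gcongr
    · have hyX : y ∈ Icc (-X) X := abs_le.1 hy
      have hid : Φ (t + h) y * U (y, t + h) - Φ t y * U (y, t) -
          h • (Φ t y * U (y, t) * V (y, t) + Φ t y * Vx (y, t)) =
          (Φ (t + h) y - Φ t y - h • (Φ t y * V (y, t))) * U (y, t + h) +
          (Φ t y * (U (y, t + h) - U (y, t) - h • (Vx (y, t) + U (y, t) * V (y, t) -
            V (y, t) * U (y, t))) +
          (h • (Φ t y * V (y, t))) * (U (y, t + h) - U (y, t))) := by
        simp only [smul_add, smul_sub, mul_add, mul_sub, sub_mul, smul_mul_assoc, mul_smul_comm,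
          mul_assoc]
        abel
      rw [hid]
      have hUK : ‖U (y, t + h)‖ ≤ K := hK _ ⟨hyX, by
        constructor <;> linarith [(abs_le.1 h4').1, (abs_le.1 h4').2]⟩
      refine (norm_add_le _ _).trans (add_le_add ?_ ((norm_add_le _ _).trans ?_))
      · refine (norm_mul_le _ _).trans ?_
        rw [mul_comm]
        gcongr
      · rw [add_mul]
        refine add_le_add ((norm_mul_le _ _).trans ?_) ((norm_mul_le _ _).trans ?_)
        · exact mul_le_mul (hC₁ y hyX) (h1 y hyX) (norm_nonneg _) hC₁0
        · rw [norm_smul]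
          calc ‖h‖ * ‖Φ t y * V (y, t)‖ * ‖U (y, t + h) - U (y, t)‖
              ≤ ‖h‖ * C₂ * ε := by
                gcongr
                · exact hC₂ y hyX
                · exact (h2 y hyX).le
            _ = C₂ * (ε * ‖h‖) := by ring
  -- joint continuity
  have hFc : Continuous fun p : ℝ × ℝ => Φ p.2 p.1 := by
    rw [continuous_iff_continuousAt]
    rintro ⟨x₀, t₀⟩
    set X := |x₀| + 1 with hX
    obtain ⟨K, hK⟩ := (isCompact_Icc.prod isCompact_Icc).exists_bound_of_continuousOn
      (s := Icc (-X) X ×ˢ Icc (t₀ - 1) (t₀ + 1)) hUc.continuousOn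
    obtain ⟨C, hC⟩ := isCompact_Icc.exists_bound_of_continuousOn (s := Icc (t₀ - 1) (t₀ + 1))
      hgc.continuousOn
    have hK0 : 0 ≤ K := (norm_nonneg _).trans (hK (x₀, t₀)
      ⟨by constructor <;> linarith [neg_abs_le x₀, le_abs_self x₀], by simp⟩)
    have hbd : ∀ t ∈ Icc (t₀ - 1) (t₀ + 1), ∀ x, |x| ≤ X → ‖Φ t x‖ ≤ gronwallBound C K 0 X := by
      intro t ht x hx
      refine (norm_le_gronwallBound_abs (T := X) (K := K) (ε := 0) (f := Φ t)
        (f' := fun y => Φ t y * U (y, t)) (fun y _ => hΦ t y) (fun y hy => ?_) hx).trans ?_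
      · rw [add_zero, mul_comm]
        exact (norm_mul_le _ _).trans (by gcongr; exact hK _ ⟨abs_le.1 hy, ht⟩)
      · rw [hΦ0, gronwallBound_ε0, gronwallBound_ε0]
        have hC0 := (norm_nonneg _).trans (hC t ht)
        gcongr
        exact hC t ht
    set B := gronwallBound C K 0 X with hB
    have hlip : ∀ t ∈ Icc (t₀ - 1) (t₀ + 1), ∀ x ∈ Icc (-X) X,
        ‖Φ t x - Φ t x₀‖ ≤ B * K * ‖x - x₀‖ := by
      intro t ht x hx
      refine (convex_Icc (-X) X).norm_image_sub_le_of_norm_hasDerivWithin_le (f := Φ t)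
        (f' := fun y => Φ t y * U (y, t)) (fun y _ => (hΦ t y).hasDerivWithinAt) (fun y hy => ?_)
        (by constructor <;> linarith [neg_abs_le x₀, le_abs_self x₀]) hx
      refine (norm_mul_le _ _).trans ?_
      exact mul_le_mul (hbd t ht y (abs_le.2 hy)) (hK _ ⟨hy, ht⟩) (norm_nonneg _)
        ((norm_nonneg _).trans (hbd t ht y (abs_le.2 hy)))
    have hzero : Tendsto (fun p : ℝ × ℝ => (Φ p.2 p.1 - Φ p.2 x₀) + Φ p.2 x₀) (𝓝 (x₀, t₀))
        (𝓝 (0 + Φ t₀ x₀)) := by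
      refine Tendsto.add ?_ ?_
      · refine squeeze_zero_norm' (a := fun p : ℝ × ℝ => B * K * ‖p.1 - x₀‖) ?_ ?_
        · have hnx : Icc (-X) X ∈ 𝓝 x₀ :=
            Icc_mem_nhds (by linarith [neg_abs_le x₀]) (by linarith [le_abs_self x₀])
          have hnt : Icc (t₀ - 1) (t₀ + 1) ∈ 𝓝 t₀ := Icc_mem_nhds (by linarith) (by linarith)
          filter_upwards [prod_mem_nhds hnx hnt] with p hp using hlip p.2 hp.2 p.1 hp.1
        · have : Continuous fun p : ℝ × ℝ => B * K * ‖p.1 - x₀‖ := by fun_prop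
          have h := this.tendsto (x₀, t₀)
          simpa using h
      · exact (hFt x₀ t₀).continuousAt.tendsto.comp (continuous_snd.tendsto (x₀, t₀))
    simpa [ContinuousAt] using hzero
  refine ⟨fun p => Φ p.2 p.1, ?_, by simp [hΦ0, hg0], fun x t => hΦ t x, hFt⟩
  rw [contDiff_infty]
  intro n
  induction n with
  | zero => exact contDiff_zero.2 hFc
  | succ n ih =>
    have hn : ((n : ℕ∞) : WithTop ℕ∞) ≤ ∞ := by exact_mod_cast le_top
    exact_mod_cast contDiff_succ_of_partials (n := n) (fx := fun p => Φ p.2 p.1 * U p)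
      (ft := fun p => Φ p.2 p.1 * V p) (fun x t => hΦ t x) hFt
      (ih.mul (hU.of_le hn)) (ih.mul (hV.of_le hn))

end ZeroCurvature

/-! ### Absolutely summable Fourier coefficients -/

section WienerAlgebra

open Filter Topology
open scoped NNReal ComplexConjugate

/-- Absolutely summable sequences indexed by `ℤ`. -/
abbrev Ell1 := lp (fun _ : ℤ => ℂ) 1

namespace Ell1

theorem summable_norm (a : Ell1) : Summable fun n => ‖a n‖ := by
  have := (lp.memℓp a).summable (by simp)
  simpa using this

theorem norm_eq (a : Ell1) : ‖a‖ = ∑' n, ‖a n‖ := by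
  have := lp.norm_eq_tsum_rpow (p := 1) (by simp) a
  simpa using this

/-- The element of `Ell1` defined by an absolutely summable sequence. -/
def mk (a : ℤ → ℂ) (ha : Summable fun n => ‖a n‖) : Ell1 :=
  ⟨a, memℓp_gen (by simpa using ha)⟩

@[simp] theorem mk_apply (a : ℤ → ℂ) (ha : Summable fun n => ‖a n‖) (n : ℤ) : mk a ha n = a n := rfl

theorem norm_apply_le (a : Ell1) (n : ℤ) : ‖a n‖ ≤ ‖a‖ := by
  rw [norm_eq]; exact (summable_norm a).le_tsum n fun _ _ => norm_nonneg _

/-- Evaluation of a coefficient. -/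
def coeff (n : ℤ) : Ell1 →L[ℝ] ℂ :=
  LinearMap.mkContinuous
    { toFun := fun a => a n
      map_add' := fun _ _ => rfl
      map_smul' := fun _ _ => rfl } 1 (fun a => (norm_apply_le a n).trans_eq (one_mul _).symm)

/-- Multiplication by a bounded sequence. -/
def diag (m : ℤ → ℂ) (C : ℝ) (hm : ∀ n, ‖m n‖ ≤ C) : Ell1 →L[ℝ] Ell1 :=
  have hs : ∀ a : Ell1, Summable fun n => ‖m n * a n‖ := fun a =>
    Summable.of_nonneg_of_le (fun _ => norm_nonneg _)
      (fun n => (norm_mul_le _ _).trans (mul_le_mul_of_nonneg_right (hm n) (norm_nonneg _)))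
      ((summable_norm a).mul_left C)
  LinearMap.mkContinuous
    { toFun := fun a => mk (fun n => m n * a n) (hs a)
      map_add' := fun a b => by ext n; simp [mul_add]
      map_smul' := fun r a => by ext n; simp; ring } C (fun a => by
        rw [norm_eq, norm_eq, ← tsum_mul_left]
        exact (hs a).tsum_le_tsum (fun n => (norm_mul_le _ _).trans
          (mul_le_mul_of_nonneg_right (hm n) (norm_nonneg _))) ((summable_norm a).mul_left C))

@[simp] theorem diag_apply (m : ℤ → ℂ) (C : ℝ) (hm : ∀ n, ‖m n‖ ≤ C) (a : Ell1) (n : ℤ) :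
    diag m C hm a n = m n * a n := rfl

/-- Conjugation, acting on Fourier coefficients. -/
def cj (a : Ell1) : Ell1 := mk (fun n => conj (a (-n)))
  (by simpa [Function.comp_def] using (Equiv.neg ℤ).summable_iff.2 (summable_norm a))

@[simp] theorem cj_apply (a : Ell1) (n : ℤ) : cj a n = conj (a (-n)) := rfl

theorem cj_sub (a b : Ell1) : cj (a - b) = cj a - cj b := by ext n; simp

theorem norm_cj (a : Ell1) : ‖cj a‖ = ‖a‖ := by
  rw [norm_eq, norm_eq, ← (Equiv.neg ℤ).tsum_eq]; simp

theorem summable_conv {R : Type*} [NormedRing R] [CompleteSpace R] {f g : ℤ → R}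
    (hf : Summable fun n => ‖f n‖) (hg : Summable fun n => ‖g n‖) :
    Summable fun p : ℤ × ℤ => f p.2 * g (p.1 - p.2) := by
  let e : ℤ × ℤ ≃ ℤ × ℤ :=
    { toFun := fun p => (p.2, p.1 - p.2)
      invFun := fun p => (p.1 + p.2, p.1)
      left_inv := fun p => by simp
      right_inv := fun p => by simp }
  exact e.summable_iff.2 (summable_mul_of_summable_norm hf hg)

theorem hasSum_conv {R : Type*} [NormedRing R] [CompleteSpace R] {f g : ℤ → R}
    (hf : Summable fun n => ‖f n‖) (hg : Summable fun n => ‖g n‖) :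
    HasSum (fun n => ∑' k, f k * g (n - k)) ((∑' n, f n) * ∑' n, g n) := by
  let e : ℤ × ℤ ≃ ℤ × ℤ :=
    { toFun := fun p => (p.2, p.1 - p.2)
      invFun := fun p => (p.1 + p.2, p.1)
      left_inv := fun p => by simp
      right_inv := fun p => by simp }
  have h1 : HasSum (fun p : ℤ × ℤ => f p.1 * g p.2) ((∑' n, f n) * ∑' n, g n) := by
    rw [tsum_mul_tsum_of_summable_norm hf hg]
    exact (summable_mul_of_summable_norm hf hg).hasSum
  have h2 : HasSum (fun p : ℤ × ℤ => f p.2 * g (p.1 - p.2)) ((∑' n, f n) * ∑' n, g n) :=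
    e.hasSum_iff.2 h1
  exact h2.prod_fiberwise fun n => ((summable_conv hf hg).prod_factor n).hasSum

theorem summable_norm_conv (a b : Ell1) : Summable fun n => ‖∑' k, a k * b (n - k)‖ := by
  have ha : Summable fun n => ‖‖a n‖‖ := by simpa using summable_norm a
  have hb : Summable fun n => ‖‖b n‖‖ := by simpa using summable_norm b
  refine Summable.of_nonneg_of_le (fun _ => norm_nonneg _) (fun n => ?_) (hasSum_conv ha hb).summable
  refine (norm_tsum_le_tsum_norm ?_).trans (by simp)
  simpa using (summable_conv ha hb).prod_factor n

theorem summable_conv_apply (a b : Ell1) (n : ℤ) : Summable fun k => a k * b (n - k) :=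
  (summable_conv (summable_norm a) (summable_norm b)).prod_factor n

/-- Convolution, acting on Fourier coefficients. -/
def conv (a b : Ell1) : Ell1 := mk (fun n => ∑' k, a k * b (n - k)) (summable_norm_conv a b)

@[simp] theorem conv_apply (a b : Ell1) (n : ℤ) : conv a b n = ∑' k, a k * b (n - k) := rfl

theorem conv_sub_left (a b c : Ell1) : conv (a - b) c = conv a c - conv b c := by
  ext n
  simp only [conv_apply, lp.coeFn_sub, Pi.sub_apply, sub_mul]
  exact (summable_conv_apply a c n).tsum_sub (summable_conv_apply b c n)

theorem conv_sub_right (a b c : Ell1) : conv a (b - c) = conv a b - conv a c := by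
  ext n
  simp only [conv_apply, lp.coeFn_sub, Pi.sub_apply, mul_sub]
  exact (summable_conv_apply a b n).tsum_sub (summable_conv_apply a c n)

theorem norm_diag_conv_le {m : ℤ → ℝ} {B C : ℝ} (hm : ∀ n, ‖(m n : ℂ)‖ ≤ B) (hm0 : ∀ n, 0 ≤ m n)
    (hC : ∀ k l, m (k + l) ≤ C * (m k + m l)) (a b : Ell1) :
    ‖diag (fun n => m n) B hm (conv a b)‖ ≤
      C * (‖diag (fun n => m n) B hm a‖ * ‖b‖ + ‖a‖ * ‖diag (fun n => m n) B hm b‖) := by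
  have s1 : Summable fun n => ‖‖diag (fun n => m n) B hm a n‖‖ := by
    simpa only [norm_norm] using summable_norm _
  have s2 : Summable fun n => ‖‖diag (fun n => m n) B hm b n‖‖ := by
    simpa only [norm_norm] using summable_norm _
  have sa : Summable fun n => ‖‖a n‖‖ := by simpa using summable_norm a
  have sb : Summable fun n => ‖‖b n‖‖ := by simpa using summable_norm b
  have hS := ((hasSum_conv s1 sb).add (hasSum_conv sa s2)).mul_left C
  rw [← norm_eq, ← norm_eq, ← norm_eq, ← norm_eq] at hS
  rw [norm_eq (diag _ B hm (conv a b)), ← hS.tsum_eq]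
  refine (summable_norm _).tsum_le_tsum (fun n => ?_) hS.summable
  have e1 := (summable_conv s1 sb).prod_factor n
  have e2 := (summable_conv sa s2).prod_factor n
  have e0 := (summable_conv sa sb).prod_factor n
  simp only at e1 e2 e0
  rw [← e1.tsum_add e2, ← tsum_mul_left]
  simp only [diag_apply, conv_apply, norm_mul]
  calc ‖(m n : ℂ)‖ * ‖∑' k, a k * b (n - k)‖
      ≤ ‖(m n : ℂ)‖ * ∑' k, ‖a k‖ * ‖b (n - k)‖ := by
        gcongr
        refine (norm_tsum_le_tsum_norm ?_).trans (by simp)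
        simpa using e0
    _ = ∑' k, ‖(m n : ℂ)‖ * (‖a k‖ * ‖b (n - k)‖) := tsum_mul_left.symm
    _ ≤ _ := by
      refine (e0.mul_left _).tsum_le_tsum (fun k => ?_) ?_
      · have h := hC k (n - k)
        rw [add_sub_cancel] at h
        simp only [Complex.norm_real, Real.norm_of_nonneg (hm0 _)]
        have := mul_le_mul_of_nonneg_right h
          (mul_nonneg (norm_nonneg (a k)) (norm_nonneg (b (n - k))))
        linarith
      · simpa only [diag_apply, norm_mul] using (e1.add e2).mul_left C

theorem norm_conv_le (a b : Ell1) : ‖conv a b‖ ≤ ‖a‖ * ‖b‖ := by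
  have h := norm_diag_conv_le (m := fun _ => 1) (B := 1) (C := 1 / 2) (by simp) (by simp)
    (by intros; norm_num) a b
  have e : ∀ c : Ell1, diag (fun _ => ((1 : ℝ) : ℂ)) 1 (by simp) c = c := fun c => by ext n; simp
  simp only [e] at h
  linarith

/-- The cubic nonlinearity `|q|² q`, acting on Fourier coefficients. -/
def cubic (a : Ell1) : Ell1 := conv (conv a (cj a)) a

theorem norm_cubic_sub_le {a b : Ell1} {R : ℝ} (ha : ‖a‖ ≤ R) (hb : ‖b‖ ≤ R) :
    ‖cubic a - cubic b‖ ≤ 3 * R ^ 2 * ‖a - b‖ := by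
  have hR : 0 ≤ R := (norm_nonneg _).trans ha
  have e : cubic a - cubic b = conv (conv (a - b) (cj a)) a + conv (conv b (cj (a - b))) a +
      conv (conv b (cj b)) (a - b) := by
    simp only [cubic, cj_sub, conv_sub_left, conv_sub_right]
    abel
  have h3 : ∀ x y z : Ell1, ‖conv (conv x y) z‖ ≤ ‖x‖ * ‖y‖ * ‖z‖ := fun x y z =>
    (norm_conv_le _ _).trans (mul_le_mul_of_nonneg_right (norm_conv_le _ _) (norm_nonneg _))
  rw [e]
  refine (norm_add₃_le).trans ?_
  have i1 : ‖conv (conv (a - b) (cj a)) a‖ ≤ ‖a - b‖ * R * R := by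
    refine (h3 _ _ _).trans ?_
    rw [norm_cj]; gcongr
  have i2 : ‖conv (conv b (cj (a - b))) a‖ ≤ R * ‖a - b‖ * R := by
    refine (h3 _ _ _).trans ?_
    rw [norm_cj]; gcongr
  have i3 : ‖conv (conv b (cj b)) (a - b)‖ ≤ R * R * ‖a - b‖ := by
    refine (h3 _ _ _).trans ?_
    rw [norm_cj]; gcongr
  nlinarith

theorem norm_diag_cubic_le {m : ℤ → ℝ} {B C : ℝ} (hm : ∀ n, ‖(m n : ℂ)‖ ≤ B)
    (hm0 : ∀ n, 0 ≤ m n) (hC0 : 0 ≤ C) (hC : ∀ k l, m (k + l) ≤ C * (m k + m l))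
    (hev : ∀ n, m (-n) = m n) (a : Ell1) :
    ‖diag (fun n => m n) B hm (cubic a)‖ ≤
      (2 * C ^ 2 + C) * ‖a‖ ^ 2 * ‖diag (fun n => m n) B hm a‖ := by
  have hcj : ‖diag (fun n => m n) B hm (cj a)‖ = ‖diag (fun n => m n) B hm a‖ := by
    rw [norm_eq, norm_eq, ← (Equiv.neg ℤ).tsum_eq]; simp [hev]
  have h1 := norm_diag_conv_le hm hm0 hC (conv a (cj a)) a
  have h2 := norm_diag_conv_le hm hm0 hC a (cj a)
  rw [hcj, norm_cj] at h2
  have h3 := norm_conv_le a (cj a)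
  rw [norm_cj] at h3
  calc ‖diag (fun n => m n) B hm (cubic a)‖
      ≤ C * (‖diag (fun n => m n) B hm (conv a (cj a))‖ * ‖a‖ +
        ‖conv a (cj a)‖ * ‖diag (fun n => m n) B hm a‖) := h1
    _ ≤ C * (C * (‖diag (fun n => m n) B hm a‖ * ‖a‖ + ‖a‖ * ‖diag (fun n => m n) B hm a‖) * ‖a‖ +
        ‖a‖ * ‖a‖ * ‖diag (fun n => m n) B hm a‖) := by gcongr
    _ = _ := by ring

/-- The symbol of the free Schrödinger evolution. -/
def phase (t : ℝ) (n : ℤ) : ℂ := Complex.exp (((-(Real.pi ^ 2 * n ^ 2 * t) : ℝ) : ℂ) * Complex.I)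

theorem norm_phase (t : ℝ) (n : ℤ) : ‖phase t n‖ = 1 := Complex.norm_exp_ofReal_mul_I _

theorem phase_neg_mul (t : ℝ) (n : ℤ) : phase (-t) n * phase t n = 1 := by
  rw [phase, phase, ← Complex.exp_add]; simp

theorem phase_even (t : ℝ) (n : ℤ) : phase t (-n) = phase t n := by simp [phase]

theorem continuous_phase (n : ℤ) : Continuous fun t => phase t n := by
  unfold phase; fun_prop

theorem hasDerivAt_phase (n : ℤ) (t : ℝ) :
    HasDerivAt (fun s => phase s n) (-(Complex.I * Real.pi ^ 2 * n ^ 2) * phase t n) t := by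
  have h : HasDerivAt (fun s : ℝ => ((-(Real.pi ^ 2 * n ^ 2 * s) : ℝ) : ℂ) * Complex.I)
      (((-(Real.pi ^ 2 * n ^ 2 * 1) : ℝ) : ℂ) * Complex.I) t :=
    (((hasDerivAt_id t).const_mul _).neg.ofReal_comp).mul_const _
  have := h.cexp
  refine this.congr_deriv ?_
  simp only [phase]; push_cast; ring

/-- The free Schrödinger evolution. -/
def prop (t : ℝ) : Ell1 →L[ℝ] Ell1 := diag (phase t) 1 fun n => (norm_phase t n).le

@[simp] theorem prop_apply (t : ℝ) (a : Ell1) (n : ℤ) : prop t a n = phase t n * a n := rfl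

theorem norm_prop (t : ℝ) (a : Ell1) : ‖prop t a‖ = ‖a‖ := by
  simp [norm_eq, norm_phase]

theorem norm_diag_prop (m : ℤ → ℂ) (B : ℝ) (hm : ∀ n, ‖m n‖ ≤ B) (t : ℝ) (a : Ell1) :
    ‖diag m B hm (prop t a)‖ = ‖diag m B hm a‖ := by
  simp [norm_eq, norm_phase]

theorem continuous_prop (a : Ell1) : Continuous fun t => prop t a := by
  rw [continuous_iff_continuousAt]
  intro t₀
  rw [ContinuousAt, tendsto_iff_norm_sub_tendsto_zero]
  have : Tendsto (fun t => ∑' n, ‖(phase t n - phase t₀ n) * a n‖) (𝓝 t₀)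
      (𝓝 (∑' n : ℤ, (0 : ℝ))) := by
    refine tendsto_tsum_of_dominated_convergence (bound := fun n => 2 * ‖a n‖)
      ((summable_norm a).mul_left 2) (fun n => ?_) (Eventually.of_forall fun t n => ?_)
    · have hc : Continuous fun t => ‖(phase t n - phase t₀ n) * a n‖ := by
        have := continuous_phase n
        fun_prop
      simpa using hc.tendsto t₀
    · rw [norm_norm, norm_mul]
      gcongr
      refine (norm_sub_le _ _).trans ?_
      rw [norm_phase, norm_phase]; norm_num
  simpa [norm_eq, sub_mul] using this

/-- The nonlinear Schrödinger vector field in the interaction picture. -/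
def field (t : ℝ) (c : Ell1) : Ell1 := (Complex.I / 2) • prop (-t) (cubic (prop t c))

theorem continuous_field (c : Ell1) : Continuous fun t => field t c := by
  have hcub : Continuous cubic := by
    rw [continuous_iff_continuousAt]
    intro a
    rw [ContinuousAt, tendsto_iff_norm_sub_tendsto_zero]
    have hb : ∀ᶠ b in 𝓝 a, ‖cubic b - cubic a‖ ≤ 3 * (‖a‖ + 1) ^ 2 * ‖b - a‖ := by
      filter_upwards [continuous_norm.continuousAt.eventually_lt_const (lt_add_one ‖a‖)] with b hb
      exact norm_cubic_sub_le hb.le (by linarith)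
    refine squeeze_zero' (Eventually.of_forall fun _ => norm_nonneg _) hb ?_
    have : Continuous fun b => 3 * (‖a‖ + 1) ^ 2 * ‖b - a‖ := by fun_prop
    simpa using this.tendsto a
  have h2 : Continuous fun t => prop (-t) (cubic (prop t c)) := by
    rw [continuous_iff_continuousAt]
    intro t₀
    set z : ℝ → Ell1 := fun t => cubic (prop t c) with hz
    have hzc : Continuous z := hcub.comp (continuous_prop c)
    have e : (fun t => prop (-t) (z t)) = fun t => prop (-t) (z t - z t₀) + prop (-t) (z t₀) := by
      funext t; rw [← map_add, sub_add_cancel]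
    change ContinuousAt (fun t => prop (-t) (z t)) t₀
    rw [e]
    refine ContinuousAt.add ?_ ((continuous_prop (z t₀)).comp continuous_neg).continuousAt
    rw [ContinuousAt, sub_self, map_zero, tendsto_zero_iff_norm_tendsto_zero]
    simp only [norm_prop]
    have : Continuous fun t => ‖z t - z t₀‖ := by fun_prop
    simpa using this.tendsto t₀
  exact h2.const_smul (Complex.I / 2)

theorem locLip_field : LocLip field := by
  intro T R
  refine ⟨⟨3 * R ^ 2, by positivity⟩, fun t _ => LipschitzOnWith.of_dist_le_mul fun a ha b hb => ?_⟩
  rw [mem_closedBall_zero_iff] at ha hb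
  rw [dist_eq_norm, dist_eq_norm, field, field, ← smul_sub, ← map_sub, norm_smul, norm_prop]
  have := norm_cubic_sub_le (a := prop t a) (b := prop t b) (R := R) (by rwa [norm_prop])
    (by rwa [norm_prop])
  rw [← map_sub, norm_prop] at this
  have h2 : ‖Complex.I / 2‖ ≤ 1 := by simp; norm_num
  calc ‖Complex.I / 2‖ * ‖cubic (prop t a) - cubic (prop t b)‖ ≤ 1 * (3 * R ^ 2 * ‖a - b‖) := by
        gcongr
    _ = _ := by rw [one_mul]; rfl

theorem norm_diag_field_le {m : ℤ → ℝ} {B C : ℝ} (hm : ∀ n, ‖(m n : ℂ)‖ ≤ B)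
    (hm0 : ∀ n, 0 ≤ m n) (hC0 : 0 ≤ C) (hC : ∀ k l, m (k + l) ≤ C * (m k + m l))
    (hev : ∀ n, m (-n) = m n) (t : ℝ) (c : Ell1) :
    ‖diag (fun n => m n) B hm (field t c)‖ ≤
      (2 * C ^ 2 + C) * ‖c‖ ^ 2 * ‖diag (fun n => m n) B hm c‖ := by
  have e : diag (fun n => m n) B hm (field t c) =
      (Complex.I / 2) • diag (fun n => m n) B hm (prop (-t) (cubic (prop t c))) := by
    ext n
    simp only [field, diag_apply, lp.coeFn_smul, Pi.smul_apply, smul_eq_mul, prop_apply]; ring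
  rw [e, norm_smul, norm_diag_prop]
  have h := norm_diag_cubic_le hm hm0 hC0 hC hev (prop t c)
  rw [norm_diag_prop, norm_prop] at h
  have h2 : ‖Complex.I / 2‖ ≤ 1 := by simp; norm_num
  calc _ ≤ 1 * _ := mul_le_mul h2 h (norm_nonneg _) zero_le_one
    _ = _ := one_mul _

end Ell1

end WienerAlgebra

/-! ### Fourier series with rapidly decreasing coefficients -/

section FourierSeries

open Filter Topology
open scoped ComplexConjugate

/-- The characters of period `2`. -/
def chi (n : ℤ) (x : ℝ) : ℂ := Complex.exp (((Real.pi * n * x : ℝ) : ℂ) * Complex.I)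

theorem norm_chi (n : ℤ) (x : ℝ) : ‖chi n x‖ = 1 := Complex.norm_exp_ofReal_mul_I _

theorem continuous_chi (n : ℤ) : Continuous (chi n) := by unfold chi; fun_prop

theorem chi_zero (x : ℝ) : chi 0 x = 1 := by simp [chi]

theorem chi_mul_chi_sub (k n : ℤ) (x : ℝ) : chi k x * chi (n - k) x = chi n x := by
  rw [chi, chi, chi, ← Complex.exp_add]; congr 1; push_cast; ring

theorem conj_chi (n : ℤ) (x : ℝ) : conj (chi n x) = chi (-n) x := by
  rw [chi, chi, ← Complex.exp_conj]; congr 1; simp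

theorem chi_neg_right (n : ℤ) (x : ℝ) : chi n (-x) = chi (-n) x := by
  rw [chi, chi]; congr 1; push_cast; ring

theorem chi_two (n : ℤ) : chi n 2 = 1 := by
  rw [chi, Complex.exp_eq_one_iff]; exact ⟨n, by push_cast; ring⟩

theorem chi_add (n : ℤ) (x y : ℝ) : chi n (x + y) = chi n x * chi n y := by
  rw [chi, chi, chi, ← Complex.exp_add]; congr 1; push_cast; ring

theorem chi_add_two (n : ℤ) (x : ℝ) : chi n (x + 2) = chi n x := by
  rw [chi_add, chi_two, mul_one]

theorem hasDerivAt_chi (n : ℤ) (x : ℝ) :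
    HasDerivAt (chi n) (Complex.I * Real.pi * n * chi n x) x := by
  have h : HasDerivAt (fun s : ℝ => ((Real.pi * n * s : ℝ) : ℂ) * Complex.I)
      (((Real.pi * n * 1 : ℝ) : ℂ) * Complex.I) x :=
    (((hasDerivAt_id x).const_mul _).ofReal_comp).mul_const _
  refine h.cexp.congr_deriv ?_
  simp only [chi]; push_cast; ring

theorem integral_chi {n : ℤ} (hn : n ≠ 0) : ∫ x in (0:ℝ)..2, chi n x = 0 := by
  have hc : Complex.I * Real.pi * n ≠ 0 := by
    simp [Real.pi_ne_zero, hn]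
  have h := intervalIntegral.integral_eq_sub_of_hasDerivAt (a := 0) (b := 2)
    (fun x _ => hasDerivAt_chi n x) (by
      apply Continuous.intervalIntegrable
      have := continuous_chi n
      fun_prop)
  rw [intervalIntegral.integral_const_mul, chi_two] at h
  have h0 : chi n 0 = 1 := by simp [chi]
  rw [h0, sub_self] at h
  exact (mul_eq_zero.1 h).resolve_left hc

/-- The Fourier series with given coefficients. -/
def four (a : ℤ → ℂ) (x : ℝ) : ℂ := ∑' n, a n * chi n x

theorem summable_norm_mul_chi {a : ℤ → ℂ} (ha : Summable fun n => ‖a n‖) (x : ℝ) :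
    Summable fun n => ‖a n * chi n x‖ := by simpa [norm_chi] using ha

theorem hasSum_four {a : ℤ → ℂ} (ha : Summable fun n => ‖a n‖) (x : ℝ) :
    HasSum (fun n => a n * chi n x) (four a x) := (summable_norm_mul_chi ha x).of_norm.hasSum

theorem four_add_two (a : ℤ → ℂ) (x : ℝ) : four a (x + 2) = four a x := by
  simp [four, chi_add_two]

theorem four_neg_of_odd {a : ℤ → ℂ} (ha : ∀ n, a (-n) = -a n) (x : ℝ) :
    four a (-x) = -four a x := by
  rw [four, four, ← (Equiv.neg ℤ).tsum_eq, ← tsum_neg]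
  simp [chi_neg_right, ha]

theorem four_zero_of_odd {a : ℤ → ℂ} (ha : ∀ n, a (-n) = -a n) : four a 0 = 0 := by
  have h := four_neg_of_odd ha 0
  rw [neg_zero] at h
  exact self_eq_neg.1 h

theorem four_one_of_odd {a : ℤ → ℂ} (ha : ∀ n, a (-n) = -a n) : four a 1 = 0 := by
  have h := four_neg_of_odd ha 1
  rw [← four_add_two] at h
  norm_num at h
  exact self_eq_neg.1 h

theorem integral_four {a : ℤ → ℂ} (ha : Summable fun n => ‖a n‖) :
    ∫ x in (0:ℝ)..2, four a x = 2 * a 0 := by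
  have h : HasSum (fun n => ∫ x in (0:ℝ)..2, a n * chi n x) (∫ x in (0:ℝ)..2, four a x) := by
    refine intervalIntegral.hasSum_integral_of_dominated_convergence (fun n _ => ‖a n‖)
      (fun n => ?_) (fun n => ?_) ?_ ?_ ?_
    · exact (continuous_const.mul (continuous_chi n)).aestronglyMeasurable
    · exact Eventually.of_forall fun x _ => by simp [norm_chi]
    · exact Eventually.of_forall fun x _ => ha
    · simp
    · exact Eventually.of_forall fun x _ => hasSum_four ha x
  refine h.unique ?_
  have : (fun n => ∫ x in (0:ℝ)..2, a n * chi n x) = fun n => if n = 0 then 2 * a 0 else 0 := by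
    funext n
    rw [intervalIntegral.integral_const_mul]
    split_ifs with hn
    · subst hn; simp [chi_zero, mul_comm]
    · rw [integral_chi hn, mul_zero]
  rw [this]
  exact hasSum_ite_eq 0 _

theorem four_conv (a b : Ell1) (x : ℝ) :
    four (Ell1.conv a b) x = four a x * four b x := by
  have h := Ell1.hasSum_conv (summable_norm_mul_chi (Ell1.summable_norm a) x)
    (summable_norm_mul_chi (Ell1.summable_norm b) x)
  refine Eq.trans ?_ h.tsum_eq
  refine tsum_congr fun n => ?_
  rw [Ell1.conv_apply, ← tsum_mul_right]
  refine tsum_congr fun k => ?_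
  rw [← chi_mul_chi_sub k n x]; ring

theorem four_cj (a : Ell1) (x : ℝ) : four (Ell1.cj a) x = conj (four a x) := by
  rw [four, four, Complex.conj_tsum, ← (Equiv.neg ℤ).tsum_eq]
  simp [conj_chi]

theorem four_cubic (a : Ell1) (x : ℝ) :
    four (Ell1.cubic a) x = four a x * conj (four a x) * four a x := by
  rw [Ell1.cubic, four_conv, four_conv, four_cj]

theorem hasSum_norm_sq_coeff (a : Ell1) :
    HasSum (fun n => ‖a n‖ ^ 2) ((∫ x in (0:ℝ)..2, ‖four a x‖ ^ 2) / 2) := by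
  have h1 := integral_four (Ell1.summable_norm (Ell1.conv a (Ell1.cj a)))
  have h2 := (Ell1.summable_conv_apply a (Ell1.cj a) 0).hasSum
  rw [← Ell1.conv_apply] at h2
  have e : ∀ x, four (Ell1.conv a (Ell1.cj a)) x = ((‖four a x‖ ^ 2 : ℝ) : ℂ) := fun x => by
    rw [four_conv, four_cj, Complex.mul_conj, Complex.normSq_eq_norm_sq]
  simp only [e] at h1
  rw [intervalIntegral.integral_ofReal] at h1
  have e2 : ∀ k, a k * Ell1.cj a (0 - k) = ((‖a k‖ ^ 2 : ℝ) : ℂ) := fun k => by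
    rw [Ell1.cj_apply, zero_sub, neg_neg, Complex.mul_conj, Complex.normSq_eq_norm_sq]
  simp only [e2] at h2
  rw [← Complex.hasSum_ofReal]
  convert h2 using 1
  push_cast
  rw [h1]; ring

end FourierSeries

section RapidDecay

open Filter Topology
open scoped ComplexConjugate

theorem summable_one_add_abs_sq_inv : Summable fun n : ℤ => ((1 + |(n : ℝ)|) ^ 2)⁻¹ := by
  have h := (Real.summable_one_div_int_pow (p := 2)).2 (by norm_num)
  refine Summable.of_nonneg_of_le (fun n => by positivity) (fun n => ?_)
    (h.add (hasSum_ite_eq (0 : ℤ) (1 : ℝ)).summable)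
  by_cases hn : n = 0
  · simp [hn]
  · have : 0 < |(n : ℝ)| := by positivity
    rw [if_neg hn, add_zero, ← one_div, ← sq_abs (n : ℝ)]
    gcongr
    linarith

/-- The family of sequences `b t` is rapidly decreasing, locally uniformly for `|t| < τ`. -/
def RapidOn (τ : ℝ) (b : ℝ → ℤ → ℂ) : Prop :=
  ∀ s : ℕ, ∀ t₁ < τ, ∃ B : ℝ, ∀ t, |t| ≤ t₁ → ∀ n : ℤ, (1 + |(n : ℝ)|) ^ s * ‖b t n‖ ≤ B

/-- Coefficients of the derivative of a Fourier series. -/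
def dcoeff (b : ℝ → ℤ → ℂ) : ℝ → ℤ → ℂ := fun t n => Complex.I * Real.pi * n * b t n

namespace RapidOn

variable {τ : ℝ} {b b' : ℝ → ℤ → ℂ}

theorem exists_bound (hb : RapidOn τ b) {t₁ : ℝ} (ht₁ : t₁ < τ) :
    ∃ v : ℤ → ℝ, Summable v ∧ ∀ t, |t| ≤ t₁ → ∀ n, ‖b t n‖ ≤ v n := by
  obtain ⟨B, hB⟩ := hb 2 t₁ ht₁
  refine ⟨_, summable_one_add_abs_sq_inv.mul_left B, fun t ht n => ?_⟩
  rw [← div_eq_mul_inv, le_div_iff₀ (by positivity), mul_comm]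
  exact hB t ht n

theorem summable_norm (hb : RapidOn τ b) {t : ℝ} (ht : |t| < τ) : Summable fun n => ‖b t n‖ := by
  obtain ⟨v, hv, h⟩ := hb.exists_bound ht
  exact Summable.of_nonneg_of_le (fun _ => norm_nonneg _) (h t le_rfl) hv

theorem smul_freq (hb : RapidOn τ b) : RapidOn τ (dcoeff b) := by
  intro s t₁ ht₁
  obtain ⟨B, hB⟩ := hb (s + 1) t₁ ht₁
  refine ⟨Real.pi * B, fun t ht n => ?_⟩
  have h : ‖dcoeff b t n‖ = Real.pi * (|(n : ℝ)| * ‖b t n‖) := by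
    simp [dcoeff, abs_of_pos Real.pi_pos, mul_assoc]
  rw [h]
  calc (1 + |(n : ℝ)|) ^ s * (Real.pi * (|(n : ℝ)| * ‖b t n‖))
      ≤ (1 + |(n : ℝ)|) ^ s * (Real.pi * ((1 + |(n : ℝ)|) * ‖b t n‖)) := by gcongr; linarith
    _ = Real.pi * ((1 + |(n : ℝ)|) ^ (s + 1) * ‖b t n‖) := by ring
    _ ≤ _ := by gcongr; exact hB t ht n

theorem add (hb : RapidOn τ b) (hb' : RapidOn τ b') : RapidOn τ fun t n => b t n + b' t n := by
  intro s t₁ ht₁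
  obtain ⟨B, hB⟩ := hb s t₁ ht₁
  obtain ⟨B', hB'⟩ := hb' s t₁ ht₁
  refine ⟨B + B', fun t ht n => ?_⟩
  refine le_trans ?_ (add_le_add (hB t ht n) (hB' t ht n))
  rw [← mul_add]
  gcongr
  exact norm_add_le _ _

theorem const_mul (hb : RapidOn τ b) (z : ℂ) : RapidOn τ fun t n => z * b t n := by
  intro s t₁ ht₁
  obtain ⟨B, hB⟩ := hb s t₁ ht₁
  refine ⟨‖z‖ * B, fun t ht n => ?_⟩
  rw [norm_mul, mul_left_comm]
  gcongr
  exact hB t ht n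

theorem hasDerivAt_four (hb : RapidOn τ b) {t : ℝ} (ht : |t| < τ) (x : ℝ) :
    HasDerivAt (four (b t)) (four (dcoeff b t) x) x := by
  refine hasDerivAt_tsum (g := fun n y => b t n * chi n y)
    (g' := fun n y => dcoeff b t n * chi n y) (hb.smul_freq.summable_norm ht)
    (fun n y => ?_) (fun n y => ?_) (hasSum_four (hb.summable_norm ht) 0).summable x
  · refine ((hasDerivAt_chi n y).const_mul (b t n)).congr_deriv ?_
    simp only [dcoeff]; ring
  · simp [norm_chi]

theorem continuousOn_four (hb : RapidOn τ b) (hc : ∀ n, ContinuousOn (fun t => b t n) (Ioo (-τ) τ)) :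
    ContinuousOn (fun p : ℝ × ℝ => four (b p.2) p.1) (univ ×ˢ Ioo (-τ) τ) := by
  rintro ⟨x, t⟩ ⟨-, ht⟩
  obtain ⟨t₁, h1, h2⟩ := exists_between (abs_lt.2 ht)
  obtain ⟨v, hv, hbd⟩ := hb.exists_bound h2
  have hc' : ContinuousOn (fun p : ℝ × ℝ => four (b p.2) p.1) (univ ×ˢ Ioo (-t₁) t₁) := by
    refine continuousOn_tsum (u := v) (fun n => ?_) hv fun n p hp => ?_
    · refine ContinuousOn.mul ?_ ((continuous_chi n).comp continuous_fst).continuousOn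
      refine ((hc n).mono ?_).comp continuous_snd.continuousOn fun p hp => hp.2
      exact Ioo_subset_Ioo (by linarith) h2.le
    · rw [norm_mul, norm_chi, mul_one]
      exact hbd _ (abs_lt.2 hp.2).le n
  exact (hc'.continuousAt ((isOpen_univ.prod isOpen_Ioo).mem_nhds
    ⟨mem_univ _, abs_lt.1 h1⟩)).continuousWithinAt

theorem hasDerivAt_four_time (hb : RapidOn τ b) (hb' : RapidOn τ b')
    (hd : ∀ n, ∀ t ∈ Ioo (-τ) τ, HasDerivAt (fun s => b s n) (b' t n) t) {t : ℝ} (ht : |t| < τ)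
    (x : ℝ) : HasDerivAt (fun s => four (b s) x) (four (b' t) x) t := by
  obtain ⟨t₁, h1, h2⟩ := exists_between ht
  obtain ⟨v, hv, hbd⟩ := hb'.exists_bound h2
  refine hasDerivAt_tsum_of_isPreconnected (g := fun n s => b s n * chi n x)
    (g' := fun n s => b' s n * chi n x) (t := Ioo (-t₁) t₁) (y₀ := t) hv isOpen_Ioo
    isPreconnected_Ioo (fun n s hs => ?_) (fun n s hs => ?_) (abs_lt.1 h1)
    (hasSum_four (hb.summable_norm ht) x).summable (abs_lt.1 h1)
  · exact (hd n s (Ioo_subset_Ioo (by linarith) h2.le hs)).mul_const _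
  · rw [norm_mul, norm_chi, mul_one]
    exact hbd _ (abs_lt.2 hs).le n

end RapidOn

namespace Ell1

/-- Truncated polynomial weights. -/
def wt (s N : ℕ) (n : ℤ) : ℝ := min ((1 + |(n : ℝ)|) ^ s) N

theorem wt_nonneg (s N : ℕ) (n : ℤ) : 0 ≤ wt s N n := le_min (by positivity) N.cast_nonneg

theorem norm_wt_le (s N : ℕ) (n : ℤ) : ‖(wt s N n : ℂ)‖ ≤ N := by
  rw [Complex.norm_real, Real.norm_of_nonneg (wt_nonneg s N n)]
  exact min_le_right _ _

theorem wt_even (s N : ℕ) (n : ℤ) : wt s N (-n) = wt s N n := by simp [wt]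

theorem wt_add_le (s N : ℕ) (k l : ℤ) : wt s N (k + l) ≤ 2 ^ s * (wt s N k + wt s N l) := by
  have main : ∀ k l : ℤ, |(k : ℝ)| ≤ |(l : ℝ)| → wt s N (k + l) ≤ 2 ^ s * wt s N l := by
    intro k l h
    have h1 : (1 : ℝ) ≤ 2 ^ s := one_le_pow₀ (by norm_num)
    rw [wt, wt, mul_min_of_nonneg _ _ (by positivity), ← mul_pow]
    refine min_le_min ?_ (le_mul_of_one_le_left N.cast_nonneg h1)
    gcongr
    push_cast
    linarith [abs_add_le (k : ℝ) l]
  have hk := wt_nonneg s N k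
  have hl := wt_nonneg s N l
  rw [mul_add]
  rcases le_total |(k : ℝ)| |(l : ℝ)| with h | h
  · have := main k l h
    have : (0 : ℝ) ≤ 2 ^ s * wt s N k := by positivity
    linarith
  · have := main l k h
    rw [add_comm l k] at this
    have : (0 : ℝ) ≤ 2 ^ s * wt s N l := by positivity
    linarith

/-- Multiplication by a truncated polynomial weight. -/
def trunc (s N : ℕ) : Ell1 →L[ℝ] Ell1 := diag (fun n => wt s N n) N (norm_wt_le s N)

theorem exists_weight_le_trunc (s : ℕ) (n : ℤ) :
    ∃ N, ∀ a : Ell1, (1 + |(n : ℝ)|) ^ s * ‖a n‖ ≤ ‖trunc s N a‖ := by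
  obtain ⟨N, hN⟩ := exists_nat_ge ((1 + |(n : ℝ)|) ^ s)
  refine ⟨N, fun a => ?_⟩
  refine le_trans (le_of_eq ?_) (norm_apply_le _ n)
  rw [trunc, diag_apply, norm_mul, Complex.norm_real, Real.norm_of_nonneg (wt_nonneg s N n), wt,
    min_eq_left hN]

theorem norm_trunc_le_tsum {s : ℕ} {a : Ell1} (h : Summable fun n : ℤ => (1 + |(n : ℝ)|) ^ s * ‖a n‖)
    (N : ℕ) : ‖trunc s N a‖ ≤ ∑' n : ℤ, (1 + |(n : ℝ)|) ^ s * ‖a n‖ := by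
  rw [norm_eq]
  refine (summable_norm _).tsum_le_tsum (fun n => ?_) h
  rw [trunc, diag_apply, norm_mul, Complex.norm_real, Real.norm_of_nonneg (wt_nonneg s N n)]
  gcongr
  exact min_le_left _ _

theorem norm_prop_trunc (s N : ℕ) (t : ℝ) (a : Ell1) : ‖trunc s N (prop t a)‖ = ‖trunc s N a‖ :=
  norm_diag_prop _ _ _ _ _

variable {τ : ℝ} {c : ℝ → Ell1}

theorem exists_norm_le (hc : ∀ t ∈ Ioo (-τ) τ, HasDerivAt c (field t (c t)) t) {t₁ : ℝ}
    (ht₁ : t₁ < τ) : ∃ R, 0 ≤ R ∧ ∀ t, |t| ≤ t₁ → ‖c t‖ ≤ R := by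
  have hcont : ContinuousOn c (Icc (-t₁) t₁) := fun t ht =>
    (hc t ⟨by linarith [ht.1], by linarith [ht.2]⟩).continuousAt.continuousWithinAt
  obtain ⟨R, hR⟩ := isCompact_Icc.exists_bound_of_continuousOn hcont
  exact ⟨max R 0, le_max_right _ _, fun t ht => (hR t (abs_le.1 ht)).trans (le_max_left _ _)⟩

theorem exists_norm_trunc_le (hc : ∀ t ∈ Ioo (-τ) τ, HasDerivAt c (field t (c t)) t) {s : ℕ}
    (h0 : Summable fun n : ℤ => (1 + |(n : ℝ)|) ^ s * ‖c 0 n‖) {t₁ : ℝ} (ht₁ : t₁ < τ) :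
    ∃ B, ∀ t, |t| ≤ t₁ → ∀ N, ‖trunc s N (c t)‖ ≤ B := by
  obtain ⟨R, hR0, hR⟩ := exists_norm_le hc ht₁
  set K : ℝ := (2 * (2 ^ s) ^ 2 + 2 ^ s) * R ^ 2 with hK
  refine ⟨(∑' n : ℤ, (1 + |(n : ℝ)|) ^ s * ‖c 0 n‖) * Real.exp (K * t₁), fun t ht N => ?_⟩
  have hg := norm_le_gronwallBound_abs (f := fun t => trunc s N (c t))
    (f' := fun t => trunc s N (field t (c t))) (K := K) (ε := 0) (T := t₁)
    (fun t ht => (trunc s N).hasFDerivAt.comp_hasDerivAt t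
      (hc t (abs_lt.1 (ht.trans_lt ht₁)))) (fun t ht => by
        rw [add_zero]
        refine (norm_diag_field_le (norm_wt_le s N) (wt_nonneg s N) (by positivity) (wt_add_le s N)
          (wt_even s N) t (c t)).trans ?_
        rw [hK]
        gcongr
        · exact hR t ht
        · exact le_rfl) ht
  rw [gronwallBound_ε0] at hg
  refine hg.trans ?_
  have := norm_trunc_le_tsum h0 N
  have hK0 : 0 ≤ K := by positivity
  gcongr

/-- The Fourier coefficients of the solution. -/
def sol (c : ℝ → Ell1) (t : ℝ) : Ell1 := prop t (c t)

theorem rapidOn_sol (hc : ∀ t ∈ Ioo (-τ) τ, HasDerivAt c (field t (c t)) t)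
    (h0 : ∀ s : ℕ, Summable fun n : ℤ => (1 + |(n : ℝ)|) ^ s * ‖c 0 n‖) :
    RapidOn τ fun t => sol c t := by
  intro s t₁ ht₁
  obtain ⟨B, hB⟩ := exists_norm_trunc_le hc (h0 s) ht₁
  refine ⟨B, fun t ht n => ?_⟩
  obtain ⟨N, hN⟩ := exists_weight_le_trunc s n
  refine (hN _).trans ?_
  rw [sol, norm_prop_trunc]
  exact hB t ht N

theorem rapidOn_cubic_sol (hc : ∀ t ∈ Ioo (-τ) τ, HasDerivAt c (field t (c t)) t)
    (h0 : ∀ s : ℕ, Summable fun n : ℤ => (1 + |(n : ℝ)|) ^ s * ‖c 0 n‖) :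
    RapidOn τ fun t => cubic (sol c t) := by
  intro s t₁ ht₁
  obtain ⟨B, hB⟩ := exists_norm_trunc_le hc (h0 s) ht₁
  obtain ⟨R, hR0, hR⟩ := exists_norm_le hc ht₁
  refine ⟨(2 * (2 ^ s) ^ 2 + 2 ^ s) * R ^ 2 * B, fun t ht n => ?_⟩
  obtain ⟨N, hN⟩ := exists_weight_le_trunc s n
  refine (hN _).trans ?_
  refine (norm_diag_cubic_le (norm_wt_le s N) (wt_nonneg s N) (by positivity) (wt_add_le s N)
          (wt_even s N) (sol c t)).trans ?_
  have h1 : ‖sol c t‖ ≤ R := by rw [sol, norm_prop]; exact hR t ht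
  have h2 : ‖diag (fun n => wt s N n) N (norm_wt_le s N) (sol c t)‖ ≤ B := by
    rw [sol, norm_diag_prop]; exact hB t ht N
  gcongr

theorem hasDerivAt_sol (hc : ∀ t ∈ Ioo (-τ) τ, HasDerivAt c (field t (c t)) t) (n : ℤ) {t : ℝ}
    (ht : t ∈ Ioo (-τ) τ) : HasDerivAt (fun s => sol c s n)
      (Complex.I * dcoeff (dcoeff fun t => sol c t) t n + Complex.I / 2 * cubic (sol c t) n) t := by
  have h1 : HasDerivAt (fun s => c s n) (field t (c t) n) t :=
    (coeff n).hasFDerivAt.comp_hasDerivAt t (hc t ht)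
  have h2 := (hasDerivAt_phase n t).mul h1
  refine h2.congr_deriv ?_
  have h3 : phase t n * field t (c t) n = Complex.I / 2 * cubic (sol c t) n := by
    have : field t (c t) n = Complex.I / 2 * (phase (-t) n * cubic (sol c t) n) := rfl
    rw [this]
    linear_combination (Complex.I / 2 * cubic (sol c t) n) * phase_neg_mul t n
  rw [h3]
  simp only [dcoeff, sol, prop_apply]
  linear_combination (- Complex.I * Real.pi ^ 2 * n ^ 2 * phase t n * c t n) * Complex.I_sq

end Ell1

end RapidDecay

section Reflection

open scoped ComplexConjugate

namespace Ell1

/-- The action on Fourier coefficients of the odd reflection `q ↦ -q(-·)`. -/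
def refl : Ell1 →L[ℝ] Ell1 :=
  have hs : ∀ a : Ell1, Summable fun n => ‖-a (-n)‖ := fun a => by
    simpa [Function.comp_def] using (Equiv.neg ℤ).summable_iff.2 (summable_norm a)
  LinearMap.mkContinuous
    { toFun := fun a => mk (fun n => -a (-n)) (hs a)
      map_add' := fun a b => by ext n; simp; ring
      map_smul' := fun r a => by ext n; simp } 1 (fun a => by
        rw [norm_eq, norm_eq, one_mul, ← (Equiv.neg ℤ).tsum_eq]; simp)

@[simp] theorem refl_apply (a : Ell1) (n : ℤ) : refl a n = -a (-n) := rfl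

theorem cubic_refl (a : Ell1) : cubic (refl a) = refl (cubic a) := by
  have h1 : ∀ n, conv (refl a) (cj (refl a)) n = conv a (cj a) (-n) := fun n => by
    rw [conv_apply, conv_apply, ← (Equiv.neg ℤ).tsum_eq]
    refine tsum_congr fun k => ?_
    simp only [Equiv.neg_apply, refl_apply, cj_apply, map_neg, neg_mul_neg, neg_neg]
    rw [show n - -k = -(-n - k) by ring]
  ext n
  rw [cubic, refl_apply, cubic, conv_apply, conv_apply, ← (Equiv.neg ℤ).tsum_eq, ← tsum_neg]
  refine tsum_congr fun k => ?_
  rw [h1, Equiv.neg_apply, neg_neg, refl_apply, mul_neg, show -(n - -k) = -n - k by ring]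

theorem prop_refl (t : ℝ) (a : Ell1) : prop t (refl a) = refl (prop t a) := by
  ext n; simp [phase_even]

theorem field_refl (t : ℝ) (a : Ell1) : field t (refl a) = refl (field t a) := by
  ext n
  rw [field, prop_refl, cubic_refl, prop_refl]
  simp [field]

theorem sol_odd {τ : ℝ} {c : ℝ → Ell1} (hc : ∀ t ∈ Ioo (-τ) τ, HasDerivAt c (field t (c t)) t)
    (h0 : ∀ n, c 0 (-n) = -c 0 n) {t : ℝ} (ht : |t| < τ) (n : ℤ) :
    sol c t (-n) = -sol c t n := by
  have hτ : 0 < τ := (abs_nonneg t).trans_lt ht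
  have h := locLip_field.eqOn (t₀ := 0) (a := -τ) (b := τ) ⟨by linarith, hτ⟩ (y := c)
    (z := fun t => refl (c t)) hc (fun s hs => by
      rw [field_refl]; exact refl.hasFDerivAt.comp_hasDerivAt s (hc s hs))
    (by ext n; simp [h0]) (abs_lt.1 ht)
  have hn : c t n = -c t (-n) := by
    conv_lhs => rw [h]
    rfl
  rw [sol, prop_apply, prop_apply, phase_even, hn]; ring

end Ell1

end Reflection

section ParametricIntegrals

open Filter Topology

variable {E : Type*} [NormedAddCommGroup E] [NormedSpace ℝ E]

theorem hasDerivAt_intervalIntegral_of_continuousOn {J : Set ℝ} (hJ : IsOpen J) {ρ ρ' : ℝ → ℝ → E}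
    (hρ : ContinuousOn (fun p : ℝ × ℝ => ρ p.1 p.2) (univ ×ˢ J))
    (hρ' : ContinuousOn (fun p : ℝ × ℝ => ρ' p.1 p.2) (univ ×ˢ J))
    (hd : ∀ x, ∀ t ∈ J, HasDerivAt (fun s => ρ x s) (ρ' x t) t) (a b : ℝ) {t : ℝ} (ht : t ∈ J) :
    HasDerivAt (fun s => ∫ x in a..b, ρ x s) (∫ x in a..b, ρ' x t) t := by
  obtain ⟨ε, hε, hsub⟩ := Metric.nhds_basis_closedBall.mem_iff.1 (hJ.mem_nhds ht)
  have hcx : ∀ {f : ℝ → ℝ → E}, ContinuousOn (fun p : ℝ × ℝ => f p.1 p.2) (univ ×ˢ J) →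
      ∀ s ∈ J, Continuous fun x => f x s := fun hf s hs => by
    refine continuousOn_univ.1 (hf.comp (f := fun x : ℝ => (x, s)) (by fun_prop) ?_)
    exact fun x _ => ⟨mem_univ _, hs⟩
  obtain ⟨C, hC⟩ := (isCompact_uIcc.prod (isCompact_closedBall t ε)).exists_bound_of_continuousOn
    (hρ'.mono (prod_mono (subset_univ (uIcc a b)) hsub))
  refine (intervalIntegral.hasDerivAt_integral_of_dominated_loc_of_deriv_le
    (F := fun s x => ρ x s) (F' := fun s x => ρ' x s) (bound := fun _ => C)
    (Metric.closedBall_mem_nhds t hε) ?_ ?_ ?_ ?_ ?_ ?_).2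
  · filter_upwards [hJ.mem_nhds ht] with s hs
    exact (hcx hρ s hs).aestronglyMeasurable
  · exact (hcx hρ t ht).intervalIntegrable _ _
  · exact (hcx hρ' t ht).aestronglyMeasurable
  · exact Eventually.of_forall fun x hx s hs => hC (x, s) ⟨uIoc_subset_uIcc hx, hs⟩
  · exact intervalIntegrable_const
  · exact Eventually.of_forall fun x hx s hs => hd x s (hsub hs)

theorem integral_eq_of_conservation_law [CompleteSpace E] {τ : ℝ} {ρ ρ' j : ℝ → ℝ → E}
    (hρ : ContinuousOn (fun p : ℝ × ℝ => ρ p.1 p.2) (univ ×ˢ Ioo (-τ) τ))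
    (hρ' : ContinuousOn (fun p : ℝ × ℝ => ρ' p.1 p.2) (univ ×ˢ Ioo (-τ) τ))
    (hd : ∀ x, ∀ t ∈ Ioo (-τ) τ, HasDerivAt (fun s => ρ x s) (ρ' x t) t)
    (hj : ∀ x, ∀ t ∈ Ioo (-τ) τ, HasDerivAt (fun y => j y t) (ρ' x t) x) {a b : ℝ}
    (hab : ∀ t ∈ Ioo (-τ) τ, j b t = j a t) {t : ℝ} (ht : t ∈ Ioo (-τ) τ) :
    ∫ x in a..b, ρ x t = ∫ x in a..b, ρ x 0 := by
  have hder : ∀ s ∈ Ioo (-τ) τ, HasDerivAt (fun s => ∫ x in a..b, ρ x s) 0 s := fun s hs => by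
    have h := hasDerivAt_intervalIntegral_of_continuousOn isOpen_Ioo hρ hρ' hd a b hs
    have hc : Continuous fun x => ρ' x s :=
      continuousOn_univ.1 (hρ'.comp (f := fun x : ℝ => (x, s)) (by fun_prop)
        fun x _ => ⟨mem_univ _, hs⟩)
    rwa [intervalIntegral.integral_eq_sub_of_hasDerivAt (fun x _ => hj x s hs)
      (hc.intervalIntegrable _ _), hab s hs, sub_self] at h
  refine isOpen_Ioo.is_const_of_deriv_eq_zero isPreconnected_Ioo
    (fun s hs => (hder s hs).differentiableAt.differentiableWithinAt)
    (fun s hs => (hder s hs).deriv) ht ⟨by linarith [ht.1, ht.2], by linarith [ht.1, ht.2]⟩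

end ParametricIntegrals

section NLS

open Filter Topology
open scoped ComplexConjugate

theorem dcoeff_iterate_apply (b : ℝ → ℤ → ℂ) (k : ℕ) (t : ℝ) (n : ℤ) :
    dcoeff^[k] b t n = (Complex.I * Real.pi * n) ^ k * b t n := by
  induction k with
  | zero => simp
  | succ k ih => rw [Function.iterate_succ_apply', dcoeff, ih]; ring

theorem RapidOn.dcoeff_iterate {τ : ℝ} {b : ℝ → ℤ → ℂ} (hb : RapidOn τ b) (k : ℕ) :
    RapidOn τ (dcoeff^[k] b) := by
  induction k with
  | zero => exact hb
  | succ k ih => rw [Function.iterate_succ_apply']; exact ih.smul_freq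

namespace Ell1

/-- The spatial derivatives of the solution `q`. -/
def fld (c : ℝ → Ell1) (k : ℕ) (x t : ℝ) : ℂ := four (dcoeff^[k] (fun t => sol c t) t) x

/-- The spatial derivatives of `|q|² q`. -/
def cub (c : ℝ → Ell1) (k : ℕ) (x t : ℝ) : ℂ := four (dcoeff^[k] (fun t => cubic (sol c t)) t) x

theorem cub_zero (c : ℝ → Ell1) (x t : ℝ) :
    cub c 0 x t = fld c 0 x t * conj (fld c 0 x t) * fld c 0 x t := four_cubic (sol c t) x

theorem fld_zero_odd {c : ℝ → Ell1} {t : ℝ} (h : ∀ n, sol c t (-n) = -sol c t n) :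
    fld c 0 0 t = 0 ∧ fld c 0 1 t = 0 := ⟨four_zero_of_odd h, four_one_of_odd h⟩

theorem fld_add_two (c : ℝ → Ell1) (k : ℕ) (x t : ℝ) : fld c k (x + 2) t = fld c k x t :=
  four_add_two _ _

variable {τ : ℝ} {c : ℝ → Ell1}

theorem hasDerivAt_fld (hc : ∀ t ∈ Ioo (-τ) τ, HasDerivAt c (field t (c t)) t)
    (h0 : ∀ s : ℕ, Summable fun n : ℤ => (1 + |(n : ℝ)|) ^ s * ‖c 0 n‖) (k : ℕ) (x : ℝ) {t : ℝ}
    (ht : t ∈ Ioo (-τ) τ) : HasDerivAt (fun y => fld c k y t) (fld c (k + 1) x t) x := by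
  have h := ((rapidOn_sol hc h0).dcoeff_iterate k).hasDerivAt_four (abs_lt.2 ht) x
  rwa [← Function.iterate_succ_apply' dcoeff] at h

theorem hasDerivAt_cub (hc : ∀ t ∈ Ioo (-τ) τ, HasDerivAt c (field t (c t)) t)
    (h0 : ∀ s : ℕ, Summable fun n : ℤ => (1 + |(n : ℝ)|) ^ s * ‖c 0 n‖) (k : ℕ) (x : ℝ) {t : ℝ}
    (ht : t ∈ Ioo (-τ) τ) : HasDerivAt (fun y => cub c k y t) (cub c (k + 1) x t) x := by
  have h := ((rapidOn_cubic_sol hc h0).dcoeff_iterate k).hasDerivAt_four (abs_lt.2 ht) x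
  rwa [← Function.iterate_succ_apply' dcoeff] at h

theorem continuousOn_fld (hc : ∀ t ∈ Ioo (-τ) τ, HasDerivAt c (field t (c t)) t)
    (h0 : ∀ s : ℕ, Summable fun n : ℤ => (1 + |(n : ℝ)|) ^ s * ‖c 0 n‖) (k : ℕ) :
    ContinuousOn (fun p : ℝ × ℝ => fld c k p.1 p.2) (univ ×ˢ Ioo (-τ) τ) := by
  refine ((rapidOn_sol hc h0).dcoeff_iterate k).continuousOn_four fun n t ht => ?_
  simp only [dcoeff_iterate_apply]
  exact ((hasDerivAt_sol hc n ht).const_mul _).continuousAt.continuousWithinAt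

theorem hasDerivAt_fld_time (hc : ∀ t ∈ Ioo (-τ) τ, HasDerivAt c (field t (c t)) t)
    (h0 : ∀ s : ℕ, Summable fun n : ℤ => (1 + |(n : ℝ)|) ^ s * ‖c 0 n‖) (k : ℕ) (x : ℝ) {t : ℝ}
    (ht : t ∈ Ioo (-τ) τ) : HasDerivAt (fun s => fld c k x s)
      (Complex.I * fld c (k + 2) x t + Complex.I / 2 * cub c k x t) t := by
  have r1 := ((rapidOn_sol hc h0).dcoeff_iterate (k + 2))
  have r2 := ((rapidOn_cubic_sol hc h0).dcoeff_iterate k)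
  have h := ((rapidOn_sol hc h0).dcoeff_iterate k).hasDerivAt_four_time
    ((r1.const_mul Complex.I).add (r2.const_mul (Complex.I / 2))) (fun n s hs => by
      simp only [dcoeff_iterate_apply]
      refine ((hasDerivAt_sol hc n hs).const_mul _).congr_deriv ?_
      simp only [dcoeff]; ring) (abs_lt.2 ht) x
  refine h.congr_deriv ?_
  have s1 := (hasSum_four (r1.summable_norm (abs_lt.2 ht)) x).mul_left Complex.I
  have s2 := (hasSum_four (r2.summable_norm (abs_lt.2 ht)) x).mul_left (Complex.I / 2)
  refine Eq.trans ?_ (s1.add s2).tsum_eq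
  refine tsum_congr fun n => ?_
  ring

theorem cub_one (hc : ∀ t ∈ Ioo (-τ) τ, HasDerivAt c (field t (c t)) t)
    (h0 : ∀ s : ℕ, Summable fun n : ℤ => (1 + |(n : ℝ)|) ^ s * ‖c 0 n‖) (x : ℝ) {t : ℝ}
    (ht : t ∈ Ioo (-τ) τ) : cub c 1 x t =
      (fld c 1 x t * conj (fld c 0 x t) + fld c 0 x t * conj (fld c 1 x t)) * fld c 0 x t +
        fld c 0 x t * conj (fld c 0 x t) * fld c 1 x t := by
  have h := hasDerivAt_cub hc h0 0 x ht
  simp only [cub_zero] at h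
  have hf := hasDerivAt_fld hc h0 0 x ht
  exact h.unique ((hf.mul hf.star).mul hf)

theorem integral_mass (hc : ∀ t ∈ Ioo (-τ) τ, HasDerivAt c (field t (c t)) t)
    (h0 : ∀ s : ℕ, Summable fun n : ℤ => (1 + |(n : ℝ)|) ^ s * ‖c 0 n‖) {t : ℝ}
    (ht : t ∈ Ioo (-τ) τ) :
    ∫ x in (0:ℝ)..2, ‖fld c 0 x t‖ ^ 2 = ∫ x in (0:ℝ)..2, ‖fld c 0 x 0‖ ^ 2 := by
  have c0 := continuousOn_fld hc h0 0
  have c2 := continuousOn_fld hc h0 2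
  have hst : Continuous (conj : ℂ → ℂ) := Complex.continuous_conj
  have key := integral_eq_of_conservation_law (τ := τ) (a := 0) (b := 2)
    (ρ := fun x t => fld c 0 x t * conj (fld c 0 x t))
    (ρ' := fun x t => Complex.I * (fld c 2 x t * conj (fld c 0 x t) -
      fld c 0 x t * conj (fld c 2 x t)))
    (j := fun x t => Complex.I * (fld c 1 x t * conj (fld c 0 x t) -
      fld c 0 x t * conj (fld c 1 x t)))
    (c0.mul (hst.comp_continuousOn c0))
    (continuousOn_const.mul ((c2.mul (hst.comp_continuousOn c0)).sub
      (c0.mul (hst.comp_continuousOn c2))))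
    (fun x s hs => by
      have h := hasDerivAt_fld_time hc h0 0 x hs
      refine (h.mul h.star).congr_deriv ?_
      rw [cub_zero]
      simp only [Complex.star_def, map_add, map_mul, Complex.conj_I, map_div₀, Complex.conj_ofNat,
        Complex.conj_conj]
      ring)
    (fun x s hs => by
      have d0 := hasDerivAt_fld hc h0 0 x hs
      have d1 := hasDerivAt_fld hc h0 1 x hs
      refine (((d1.mul d0.star).sub (d0.mul d1.star)).const_mul Complex.I).congr_deriv ?_
      simp only [Complex.star_def]
      ring)
    (fun s _ => by
      have e := fun k => fld_add_two c k 0 s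
      simp only [zero_add] at e
      simp only [e])
    ht
  simp only [Complex.mul_conj, Complex.normSq_eq_norm_sq, intervalIntegral.integral_ofReal] at key
  exact_mod_cast key

theorem integral_energy (hc : ∀ t ∈ Ioo (-τ) τ, HasDerivAt c (field t (c t)) t)
    (h0 : ∀ s : ℕ, Summable fun n : ℤ => (1 + |(n : ℝ)|) ^ s * ‖c 0 n‖) {t : ℝ}
    (ht : t ∈ Ioo (-τ) τ) :
    ∫ x in (0:ℝ)..2, (‖fld c 1 x t‖ ^ 2 - ‖fld c 0 x t‖ ^ 4 / 4) =
      ∫ x in (0:ℝ)..2, (‖fld c 1 x 0‖ ^ 2 - ‖fld c 0 x 0‖ ^ 4 / 4) := by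
  have c0 := continuousOn_fld hc h0 0
  have c1 := continuousOn_fld hc h0 1
  have c2 := continuousOn_fld hc h0 2
  have c3 := continuousOn_fld hc h0 3
  have hst : Continuous (conj : ℂ → ℂ) := Complex.continuous_conj
  have k0 := hst.comp_continuousOn c0
  have k1 := hst.comp_continuousOn c1
  set p : ℝ → ℝ → ℂ := fun x t => Complex.I * fld c 2 x t +
    Complex.I / 2 * (fld c 0 x t * conj (fld c 0 x t) * fld c 0 x t) with hp
  set p' : ℝ → ℝ → ℂ := fun x t => Complex.I * fld c 3 x t + Complex.I / 2 *
    ((fld c 1 x t * conj (fld c 0 x t) + fld c 0 x t * conj (fld c 1 x t)) * fld c 0 x t +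
        fld c 0 x t * conj (fld c 0 x t) * fld c 1 x t) with hp'
  have cp : ContinuousOn (fun z : ℝ × ℝ => p z.1 z.2) (univ ×ˢ Ioo (-τ) τ) :=
    (continuousOn_const.mul c2).add (continuousOn_const.mul ((c0.mul k0).mul c0))
  have cp' : ContinuousOn (fun z : ℝ × ℝ => p' z.1 z.2) (univ ×ˢ Ioo (-τ) τ) :=
    (continuousOn_const.mul c3).add (continuousOn_const.mul
      ((((c1.mul k0).add (c0.mul k1)).mul c0).add ((c0.mul k0).mul c1)))
  have kp := hst.comp_continuousOn cp
  have kp' := hst.comp_continuousOn cp'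
  have key := integral_eq_of_conservation_law (τ := τ) (a := 0) (b := 2)
    (ρ := fun x t => fld c 1 x t * conj (fld c 1 x t) -
      (fld c 0 x t * conj (fld c 0 x t)) * (fld c 0 x t * conj (fld c 0 x t)) / 4)
    (ρ' := fun x t => p' x t * conj (fld c 1 x t) + fld c 1 x t * conj (p' x t) -
      ((p x t * conj (fld c 0 x t) + fld c 0 x t * conj (p x t)) *
        (fld c 0 x t * conj (fld c 0 x t)) + (fld c 0 x t * conj (fld c 0 x t)) *
          (p x t * conj (fld c 0 x t) + fld c 0 x t * conj (p x t))) / 4)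
    (j := fun x t => conj (fld c 1 x t) * p x t + fld c 1 x t * conj (p x t))
    ((c1.mul k1).sub (((c0.mul k0).mul (c0.mul k0)).div_const 4))
    (((cp'.mul k1).add (c1.mul kp')).sub (((((cp.mul k0).add (c0.mul kp)).mul (c0.mul k0)).add
      ((c0.mul k0).mul ((cp.mul k0).add (c0.mul kp)))).div_const 4))
    (fun x s hs => by
      have d0 := hasDerivAt_fld_time hc h0 0 x hs
      have d1 := hasDerivAt_fld_time hc h0 1 x hs
      rw [cub_zero] at d0
      rw [cub_one hc h0 x hs] at d1
      exact (d1.mul d1.star).sub (((d0.mul d0.star).mul (d0.mul d0.star)).div_const 4))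
    (fun x s hs => by
      have d0 := hasDerivAt_fld hc h0 0 x hs
      have d1 := hasDerivAt_fld hc h0 1 x hs
      have d2 := hasDerivAt_fld hc h0 2 x hs
      have dp : HasDerivAt (fun y => p y s) (p' x s) x :=
        (d2.const_mul _).add (((d0.mul d0.star).mul d0).const_mul _)
      refine ((d1.star.mul dp).add (d1.mul dp.star)).congr_deriv ?_
      simp only [hp, Complex.star_def, map_add, map_mul, Complex.conj_I, map_div₀,
        Complex.conj_ofNat, Complex.conj_conj]
      ring)
    (fun s _ => by
      have e := fun k => fld_add_two c k 0 s
      simp only [zero_add] at e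
      simp only [hp, e])
    ht
  have e : ∀ x s, fld c 1 x s * conj (fld c 1 x s) -
      (fld c 0 x s * conj (fld c 0 x s)) * (fld c 0 x s * conj (fld c 0 x s)) / 4 =
      ((‖fld c 1 x s‖ ^ 2 - ‖fld c 0 x s‖ ^ 4 / 4 : ℝ) : ℂ) := fun x s => by
    simp only [Complex.mul_conj, Complex.normSq_eq_norm_sq]; push_cast; ring
  simp only [e, intervalIntegral.integral_ofReal] at key
  exact_mod_cast key

end Ell1

end NLS

section APriori

open Filter Topology
open scoped ComplexConjugate

theorem norm_sq_le_integral {f f' : ℝ → ℂ} (hf : ∀ x, HasDerivAt f (f' x) x) (hf' : Continuous f')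
    (h0 : f 0 = 0) {l : ℝ} (hl : 0 < l) {x b : ℝ} (hx : x ∈ Icc 0 b) :
    ‖f x‖ ^ 2 ≤ l * (∫ y in (0:ℝ)..b, ‖f y‖ ^ 2) + (∫ y in (0:ℝ)..b, ‖f' y‖ ^ 2) / l := by
  have hfc : Continuous f := continuous_iff_continuousAt.2 fun x => (hf x).continuousAt
  have h1 : ∫ y in (0:ℝ)..x, 2 * inner ℝ (f y) (f' y) = ‖f x‖ ^ 2 := by
    rw [intervalIntegral.integral_eq_sub_of_hasDerivAt (f := fun y => ‖f y‖ ^ 2)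
      (fun y _ => (hf y).norm_sq) ((continuous_const.mul (hfc.inner hf')).intervalIntegrable _ _)]
    simp [h0]
  have hb : ∀ y, 2 * inner ℝ (f y) (f' y) ≤ l * ‖f y‖ ^ 2 + ‖f' y‖ ^ 2 / l := fun y => by
    have h2 := real_inner_le_norm (f y) (f' y)
    have h3 : 0 ≤ (l * ‖f y‖ - ‖f' y‖) ^ 2 / l := by positivity
    have h4 : (l * ‖f y‖ - ‖f' y‖) ^ 2 / l =
        l * ‖f y‖ ^ 2 + ‖f' y‖ ^ 2 / l - 2 * (‖f y‖ * ‖f' y‖) := by field_simp; ring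
    linarith
  have hc : Continuous fun y => l * ‖f y‖ ^ 2 + ‖f' y‖ ^ 2 / l := by fun_prop
  rw [← h1]
  calc ∫ y in (0:ℝ)..x, 2 * inner ℝ (f y) (f' y)
      ≤ ∫ y in (0:ℝ)..x, (l * ‖f y‖ ^ 2 + ‖f' y‖ ^ 2 / l) :=
        intervalIntegral.integral_mono_on hx.1
          ((continuous_const.mul (hfc.inner hf')).intervalIntegrable _ _)
          (hc.intervalIntegrable _ _) fun y _ => hb y
    _ ≤ ∫ y in (0:ℝ)..b, (l * ‖f y‖ ^ 2 + ‖f' y‖ ^ 2 / l) :=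
        intervalIntegral.integral_mono_interval le_rfl hx.1 hx.2
          (Eventually.of_forall fun y => by positivity) (hc.intervalIntegrable _ _)
    _ = _ := by
      rw [intervalIntegral.integral_add, intervalIntegral.integral_const_mul,
        intervalIntegral.integral_div]
      · exact Continuous.intervalIntegrable (by fun_prop) _ _
      · exact Continuous.intervalIntegrable (by fun_prop) _ _

theorem integral_deriv_sq_le {f f' : ℝ → ℂ} (hf : ∀ x, HasDerivAt f (f' x) x)
    (hf' : Continuous f') (h0 : f 0 = 0) {b : ℝ} (hb : 0 ≤ b) :
    ∫ y in (0:ℝ)..b, ‖f' y‖ ^ 2 ≤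
      4 / 3 * ((∫ y in (0:ℝ)..b, (‖f' y‖ ^ 2 - ‖f y‖ ^ 4 / 4)) +
        ((∫ y in (0:ℝ)..b, ‖f y‖ ^ 2) + 1) ^ 3 / 4) := by
  have hfc : Continuous f := continuous_iff_continuousAt.2 fun x => (hf x).continuousAt
  set M := ∫ y in (0:ℝ)..b, ‖f y‖ ^ 2 with hM
  set H := ∫ y in (0:ℝ)..b, ‖f' y‖ ^ 2 with hH
  have hM0 : 0 ≤ M := intervalIntegral.integral_nonneg hb fun _ _ => by positivity
  have hH0 : 0 ≤ H := intervalIntegral.integral_nonneg hb fun _ _ => by positivity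
  have h4 : ∫ y in (0:ℝ)..b, ‖f y‖ ^ 4 ≤ ((M + 1) * M + H / (M + 1)) * M := by
    rw [hM, ← intervalIntegral.integral_const_mul, ← hM]
    refine intervalIntegral.integral_mono_on hb (Continuous.intervalIntegrable (by fun_prop) _ _)
      (Continuous.intervalIntegrable (by fun_prop) _ _) fun y hy => ?_
    have := norm_sq_le_integral hf hf' h0 (show 0 < M + 1 by linarith) hy
    calc ‖f y‖ ^ 4 = ‖f y‖ ^ 2 * ‖f y‖ ^ 2 := by ring
      _ ≤ _ := by gcongr
  have hE : ∫ y in (0:ℝ)..b, (‖f' y‖ ^ 2 - ‖f y‖ ^ 4 / 4) =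
      H - (∫ y in (0:ℝ)..b, ‖f y‖ ^ 4) / 4 := by
    rw [intervalIntegral.integral_sub, intervalIntegral.integral_div]
    · exact Continuous.intervalIntegrable (by fun_prop) _ _
    · exact Continuous.intervalIntegrable (by fun_prop) _ _
  rw [hE]
  have h5 : H / (M + 1) * M ≤ H := by
    rw [div_mul_eq_mul_div, div_le_iff₀ (by linarith)]
    nlinarith
  nlinarith [mul_nonneg hM0 hM0, mul_nonneg (mul_nonneg hM0 hM0) hM0]

namespace Ell1

variable {τ : ℝ} {c : ℝ → Ell1}

theorem norm_sol_le (hc : ∀ t ∈ Ioo (-τ) τ, HasDerivAt c (field t (c t)) t)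
    (h0 : ∀ s : ℕ, Summable fun n : ℤ => (1 + |(n : ℝ)|) ^ s * ‖c 0 n‖) {t : ℝ}
    (ht : t ∈ Ioo (-τ) τ) :
    ‖sol c t‖ ≤ (∫ x in (0:ℝ)..2, ‖fld c 0 x t‖ ^ 2) + (∫ x in (0:ℝ)..2, ‖fld c 1 x t‖ ^ 2) +
      ∑' n : ℤ, ((1 + |(n : ℝ)|) ^ 2)⁻¹ := by
  have r1 := (rapidOn_sol hc h0).smul_freq.summable_norm (abs_lt.2 ht)
  have hM := hasSum_norm_sq_coeff (sol c t)
  have hH := hasSum_norm_sq_coeff (mk _ r1)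
  have hS := ((hM.add hH).mul_left 2).add summable_one_add_abs_sq_inv.hasSum
  rw [norm_eq]
  have e : 2 * ((∫ x in (0:ℝ)..2, ‖four (sol c t) x‖ ^ 2) / 2 +
      (∫ x in (0:ℝ)..2, ‖four (mk _ r1) x‖ ^ 2) / 2) + ∑' n : ℤ, ((1 + |(n : ℝ)|) ^ 2)⁻¹ =
      (∫ x in (0:ℝ)..2, ‖fld c 0 x t‖ ^ 2) + (∫ x in (0:ℝ)..2, ‖fld c 1 x t‖ ^ 2) +
      ∑' n : ℤ, ((1 + |(n : ℝ)|) ^ 2)⁻¹ := by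
    simp only [fld, Function.iterate_zero, id_eq, Function.iterate_one]
    change 2 * ((∫ x in (0:ℝ)..2, ‖four (sol c t) x‖ ^ 2) / 2 +
      (∫ x in (0:ℝ)..2, ‖four (dcoeff (fun t => sol c t) t) x‖ ^ 2) / 2) + _ = _
    ring
  rw [← e, ← hS.tsum_eq]
  refine (summable_norm _).tsum_le_tsum (fun n => ?_) hS.summable
  set z := sol c t n with hz
  have hn : ‖mk _ r1 n‖ ^ 2 = Real.pi ^ 2 * (|(n : ℝ)| ^ 2 * ‖z‖ ^ 2) := by
    rw [mk_apply, dcoeff]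
    simp only [norm_mul, Complex.norm_I, Complex.norm_real, Complex.norm_intCast, one_mul,
      Real.norm_of_nonneg Real.pi_pos.le, hz]
    ring
  rw [hn]
  set w := |(n : ℝ)| with hw
  have hw0 : 0 ≤ w := abs_nonneg _
  have hpi : 1 ≤ Real.pi ^ 2 := by nlinarith [Real.pi_gt_three]
  have h1 : w ^ 2 * ‖z‖ ^ 2 ≤ Real.pi ^ 2 * (w ^ 2 * ‖z‖ ^ 2) :=
    le_mul_of_one_le_left (by positivity) hpi
  have h2 : 0 ≤ ((1 + w) * ‖z‖ - (1 + w)⁻¹) ^ 2 := sq_nonneg _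
  have h3 : ((1 + w) * ‖z‖ - (1 + w)⁻¹) ^ 2 =
      (1 + w) ^ 2 * ‖z‖ ^ 2 + ((1 + w) ^ 2)⁻¹ - 2 * ‖z‖ := by field_simp; ring
  have h4 : 0 ≤ (1 - w) ^ 2 * ‖z‖ ^ 2 := by positivity
  nlinarith [norm_nonneg z, h4, h1, h2]

theorem exists_global_sol (a : Ell1) (hodd : ∀ n, a (-n) = -a n)
    (ha : ∀ s : ℕ, Summable fun n : ℤ => (1 + |(n : ℝ)|) ^ s * ‖a n‖) :
    ∃ c : ℝ → Ell1, c 0 = a ∧ ∀ t, HasDerivAt c (field t (c t)) t := by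
  refine locLip_field.exists_global continuous_field a fun _ => ?_
  set M := ∫ x in (0:ℝ)..2, ‖fld (fun _ => a) 0 x 0‖ ^ 2 with hM
  set E := ∫ x in (0:ℝ)..2, (‖fld (fun _ => a) 1 x 0‖ ^ 2 - ‖fld (fun _ => a) 0 x 0‖ ^ 4 / 4)
    with hE
  refine ⟨M + 4 / 3 * (E + (M + 1) ^ 3 / 4) + ∑' n : ℤ, ((1 + |(n : ℝ)|) ^ 2)⁻¹,
    fun τ hτ _ c h0 hc t ht => ?_⟩
  subst h0
  have e : ∀ k x, fld (fun _ => c 0) k x 0 = fld c k x 0 := fun k x => by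
    simp only [fld]
    congr 1
    funext n
    simp only [dcoeff_iterate_apply, sol]
  simp only [e] at hM hE
  have h1 := norm_sol_le hc ha ht
  rw [integral_mass hc ha ht, ← hM] at h1
  have hf : Continuous fun x => fld c 1 x t :=
    continuousOn_univ.1 ((continuousOn_fld hc ha 1).comp (f := fun x : ℝ => (x, t)) (by fun_prop)
        fun x _ => ⟨mem_univ _, ht⟩)
  have h2 := integral_deriv_sq_le (fun x => hasDerivAt_fld hc ha 0 x ht) hf
    (fld_zero_odd (sol_odd hc hodd (abs_lt.2 ht))).1 (zero_le_two (α := ℝ))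
  rw [integral_mass hc ha ht, integral_energy hc ha ht, ← hM, ← hE] at h2
  rw [sol, norm_prop] at h1
  linarith

/-- Linear combinations of cubic monomials in the spatial derivatives of the solution. -/
def cubicSpan (c : ℝ → Ell1) : Submodule ℂ (ℝ × ℝ → ℂ) :=
  Submodule.span ℂ {F | ∃ i j k, F = fun p => fld c i p.1 p.2 * conj (fld c j p.1 p.2) *
    fld c k p.1 p.2}

theorem mem_Ioo_abs_add_one (t : ℝ) : t ∈ Ioo (-(|t| + 1)) (|t| + 1) :=
  abs_lt.1 (lt_add_one |t|)

theorem exists_hasDerivAt_of_mem_cubicSpan (hc : ∀ t, HasDerivAt c (field t (c t)) t)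
    (h0 : ∀ s : ℕ, Summable fun n : ℤ => (1 + |(n : ℝ)|) ^ s * ‖c 0 n‖) {F : ℝ × ℝ → ℂ}
    (hF : F ∈ cubicSpan c) :
    ∃ F' ∈ cubicSpan c, ∀ x t, HasDerivAt (fun y => F (y, t)) (F' (x, t)) x := by
  induction hF using Submodule.span_induction with
  | mem F h =>
    obtain ⟨i, j, k, rfl⟩ := h
    have hm : ∀ i j k, (fun p : ℝ × ℝ => fld c i p.1 p.2 * conj (fld c j p.1 p.2) *
        fld c k p.1 p.2) ∈ cubicSpan c := fun i j k => Submodule.subset_span ⟨i, j, k, rfl⟩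
    refine ⟨_, add_mem (add_mem (hm (i + 1) j k) (hm i (j + 1) k)) (hm i j (k + 1)),
      fun x t => ?_⟩
    have hd := fun k => hasDerivAt_fld (fun t _ => hc t) h0 k x (mem_Ioo_abs_add_one t)
    refine (((hd i).mul (hd j).star).mul (hd k)).congr_deriv ?_
    simp only [Pi.add_apply, Pi.mul_apply, Complex.star_def]
    ring
  | zero => exact ⟨0, zero_mem _, fun x t => hasDerivAt_const _ _⟩
  | add F G _ _ hF hG =>
    obtain ⟨F', hF', dF⟩ := hF
    obtain ⟨G', hG', dG⟩ := hG
    exact ⟨F' + G', add_mem hF' hG', fun x t => (dF x t).add (dG x t)⟩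
  | smul z F _ hF =>
    obtain ⟨F', hF', dF⟩ := hF
    exact ⟨z • F', Submodule.smul_mem _ _ hF', fun x t => (dF x t).const_smul z⟩

theorem cub_mem_cubicSpan (hc : ∀ t, HasDerivAt c (field t (c t)) t)
    (h0 : ∀ s : ℕ, Summable fun n : ℤ => (1 + |(n : ℝ)|) ^ s * ‖c 0 n‖) (k : ℕ) :
    (fun p : ℝ × ℝ => cub c k p.1 p.2) ∈ cubicSpan c := by
  induction k with
  | zero =>
    simp only [cub_zero]
    exact Submodule.subset_span ⟨0, 0, 0, rfl⟩
  | succ k ih =>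
    obtain ⟨F', hF', dF⟩ := exists_hasDerivAt_of_mem_cubicSpan hc h0 ih
    convert hF' using 1
    funext p
    exact (hasDerivAt_cub (fun t _ => hc t) h0 k p.1 (mem_Ioo_abs_add_one p.2)).unique
      (dF p.1 p.2)

theorem contDiff_fld (hc : ∀ t, HasDerivAt c (field t (c t)) t)
    (h0 : ∀ s : ℕ, Summable fun n : ℤ => (1 + |(n : ℝ)|) ^ s * ‖c 0 n‖) (k : ℕ) :
    ContDiff ℝ (⊤ : ℕ∞) fun p : ℝ × ℝ => fld c k p.1 p.2 := by
  have main : ∀ m : ℕ, ∀ k, ContDiff ℝ m fun p : ℝ × ℝ => fld c k p.1 p.2 := by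
    intro m
    induction m with
    | zero =>
      intro k
      refine contDiff_zero.2 (continuous_iff_continuousAt.2 fun p => ?_)
      exact (continuousOn_fld (τ := |p.2| + 1) (fun t _ => hc t) h0 k).continuousAt
        ((isOpen_univ.prod isOpen_Ioo).mem_nhds ⟨mem_univ _, mem_Ioo_abs_add_one p.2⟩)
    | succ m ih =>
      intro k
      have hspan : ∀ F ∈ cubicSpan c, ContDiff ℝ m F := fun F hF => by
        induction hF using Submodule.span_induction with
        | mem F h =>
          obtain ⟨i, j, k, rfl⟩ := h
          exact ((ih i).mul (Complex.conjCLE.contDiff.comp (ih j))).mul (ih k)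
        | zero => exact contDiff_const
        | add F G _ _ hF hG => exact hF.add hG
        | smul z F _ hF => exact hF.const_smul z
      refine contDiff_succ_of_partials (fx := fun p => fld c (k + 1) p.1 p.2)
        (ft := fun p => Complex.I * fld c (k + 2) p.1 p.2 + Complex.I / 2 * cub c k p.1 p.2)
        (fun x t => hasDerivAt_fld (fun t _ => hc t) h0 k x (mem_Ioo_abs_add_one t))
        (fun x t => hasDerivAt_fld_time (fun t _ => hc t) h0 k x (mem_Ioo_abs_add_one t))
        (ih (k + 1)) ?_
      exact (contDiff_const.mul (ih (k + 2))).add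
        (contDiff_const.mul (hspan _ (cub_mem_cubicSpan hc h0 k)))
  exact contDiff_infty.2 fun m => main m k

end Ell1

end APriori

section SineSeries

open Filter Topology
open scoped ComplexConjugate

/-- Sine coefficients of a function on the unit interval. -/
def sineCoeff (f : ℝ → ℂ) (n : ℤ) : ℂ := ∫ x in (0:ℝ)..1, f x * Real.sin (Real.pi * n * x)

theorem sineCoeff_eq_of_hasDerivAt {f f' f'' : ℝ → ℂ}
    (hf : ∀ x ∈ Icc (0:ℝ) 1, HasDerivAt f (f' x) x)
    (hf' : ∀ x ∈ Icc (0:ℝ) 1, HasDerivAt f' (f'' x) x) (hf'' : ContinuousOn f'' (Icc 0 1))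
    (h0 : f 0 = 0) (h1 : f 1 = 0) (n : ℤ) :
    (Real.pi * n) ^ 2 * sineCoeff f n = -sineCoeff f'' n := by
  have hfc : ContinuousOn f (Icc 0 1) := fun x hx => (hf x hx).continuousAt.continuousWithinAt
  have hu : uIcc (0:ℝ) 1 = Icc 0 1 := uIcc_of_le zero_le_one
  have hsin : ∀ x : ℝ, HasDerivAt (fun y : ℝ => ((Real.sin (Real.pi * n * y) : ℝ) : ℂ))
      ((Real.pi * n * Real.cos (Real.pi * n * x) : ℝ) : ℂ) x := fun x => by
    have := ((hasDerivAt_id x).const_mul (Real.pi * n)).sin.ofReal_comp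
    refine this.congr_deriv ?_
    push_cast; simp only [id_eq]; ring
  have hcos : ∀ x : ℝ, HasDerivAt (fun y : ℝ => ((Real.cos (Real.pi * n * y) : ℝ) : ℂ))
      ((-(Real.pi * n * Real.sin (Real.pi * n * x)) : ℝ) : ℂ) x := fun x => by
    have := ((hasDerivAt_id x).const_mul (Real.pi * n)).cos.ofReal_comp
    refine this.congr_deriv ?_
    push_cast; simp only [id_eq]; ring
  have hcs : Continuous fun x : ℝ => ((Real.sin (Real.pi * n * x) : ℝ) : ℂ) := by fun_prop
  have i1 : IntervalIntegrable (fun x => f'' x * Real.sin (Real.pi * n * x)) volume 0 1 :=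
    (ContinuousOn.mul (by rwa [hu]) hcs.continuousOn).intervalIntegrable
  have i2 : IntervalIntegrable (fun x => (Real.pi * n : ℂ) ^ 2 * (f x * Real.sin (Real.pi * n * x)))
      volume 0 1 :=
    (continuousOn_const.mul (ContinuousOn.mul (by rwa [hu]) hcs.continuousOn)).intervalIntegrable
  have key := intervalIntegral.integral_eq_sub_of_hasDerivAt (a := 0) (b := 1)
    (f := fun x => f' x * Real.sin (Real.pi * n * x) -
      (Real.pi * n : ℂ) * (f x * Real.cos (Real.pi * n * x)))
    (f' := fun x => f'' x * Real.sin (Real.pi * n * x) +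
      (Real.pi * n : ℂ) ^ 2 * (f x * Real.sin (Real.pi * n * x))) (fun x hx => by
      rw [hu] at hx
      refine (((hf' x hx).mul (hsin x)).sub
        (((hf x hx).mul (hcos x)).const_mul _)).congr_deriv ?_
      push_cast; ring) (i1.add i2)
  rw [intervalIntegral.integral_add i1 i2, intervalIntegral.integral_const_mul, h0, h1] at key
  have hs1 : Real.sin (Real.pi * n * 1) = 0 := by
    rw [mul_one, mul_comm]; exact Real.sin_int_mul_pi n
  rw [hs1] at key
  simp only [mul_zero, Real.sin_zero, Complex.ofReal_zero, zero_mul, sub_zero] at key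
  rw [sineCoeff, sineCoeff]
  linear_combination key

theorem exists_weighted_sineCoeff_le {Q : ℕ → ℝ → ℂ}
    (hQ : ∀ j, ∀ x ∈ Icc (0:ℝ) 1, HasDerivAt (Q j) (Q (j + 1) x) x)
    (h0 : ∀ j, Q (2 * j) 0 = 0) (h1 : ∀ j, Q (2 * j) 1 = 0) (j : ℕ) :
    ∃ B, ∀ n : ℤ, (1 + |(n : ℝ)|) ^ (2 * j) * ‖sineCoeff (Q 0) n‖ ≤ B := by
  have hcont : ∀ j, ContinuousOn (Q j) (Icc 0 1) := fun j x hx =>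
    (hQ j x hx).continuousAt.continuousWithinAt
  have hit : ∀ (n : ℤ) (j : ℕ),
      ((Real.pi * n : ℂ) ^ 2) ^ j * sineCoeff (Q 0) n = (-1) ^ j * sineCoeff (Q (2 * j)) n := by
    intro n j
    induction j with
    | zero => simp
    | succ j ih =>
      have := sineCoeff_eq_of_hasDerivAt (hQ (2 * j)) (hQ (2 * j + 1)) (hcont _) (h0 j) (h1 j) n
      rw [show 2 * (j + 1) = 2 * j + 1 + 1 by ring]
      linear_combination (Real.pi * n : ℂ) ^ 2 * ih + (-1) ^ j * this
  obtain ⟨C, hC⟩ := isCompact_Icc.exists_bound_of_continuousOn (hcont (2 * j))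
  have hC0 : 0 ≤ C := (norm_nonneg _).trans (hC 0 (left_mem_Icc.2 zero_le_one))
  refine ⟨4 ^ j * C, fun n => ?_⟩
  by_cases hn : n = 0
  · have : sineCoeff (Q 0) 0 = 0 := by simp [sineCoeff]
    rw [hn, this, norm_zero, mul_zero]
    positivity
  have hn1 : (1 : ℝ) ≤ |(n : ℝ)| := by
    rw [← Int.cast_abs]; exact_mod_cast Int.one_le_abs hn
  have hS : ‖sineCoeff (Q (2 * j)) n‖ ≤ C := by
    have h := intervalIntegral.norm_integral_le_of_norm_le_const (a := 0) (b := 1) (C := C)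
      (f := fun x => Q (2 * j) x * Real.sin (Real.pi * n * x)) (fun x hx => by
        rw [uIoc_of_le zero_le_one] at hx
        rw [norm_mul, Complex.norm_real]
        calc _ ≤ C * 1 := mul_le_mul (hC x ⟨hx.1.le, hx.2⟩) (Real.abs_sin_le_one _)
              (abs_nonneg _) hC0
          _ = C := mul_one _)
    rw [sineCoeff]
    simpa using h
  have hnorm := congrArg norm (hit n j)
  simp only [norm_mul, norm_pow, norm_neg, norm_one, one_pow, one_mul, Complex.norm_real,
    Complex.norm_intCast, Real.norm_of_nonneg Real.pi_pos.le] at hnorm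
  calc (1 + |(n : ℝ)|) ^ (2 * j) * ‖sineCoeff (Q 0) n‖
      ≤ (4 * (Real.pi * |(n : ℝ)|) ^ 2) ^ j * ‖sineCoeff (Q 0) n‖ := by
        rw [pow_mul]
        gcongr
        have hp : (1 : ℝ) ≤ Real.pi := by linarith [Real.pi_gt_three]
        have : |(n : ℝ)| ≤ Real.pi * |(n : ℝ)| := le_mul_of_one_le_left (abs_nonneg _) hp
        nlinarith
    _ = 4 ^ j * (((Real.pi * |(n : ℝ)|) ^ 2) ^ j * ‖sineCoeff (Q 0) n‖) := by rw [mul_pow]; ring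
    _ ≤ _ := by rw [hnorm]; gcongr

/-- The odd extension of a function on the half-line. -/
def oddExt (f : ℝ → ℂ) (x : ℝ) : ℂ := if 0 ≤ x then f x else -f (-x)

theorem continuous_oddExt {f : ℝ → ℂ} (hf : Continuous f) (h0 : f 0 = 0) :
    Continuous (oddExt f) := by
  refine Continuous.if_le hf (by fun_prop) continuous_const continuous_id fun x hx => ?_
  rw [← show (0:ℝ) = x from hx, neg_zero, h0, neg_zero]

theorem integral_chi_mul_oddExt {f : ℝ → ℂ} (hf : Continuous f) (h0 : f 0 = 0) (n : ℤ) :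
    ∫ x in (-1:ℝ)..1, chi (-n) x * oddExt f x = -2 * Complex.I * sineCoeff f n := by
  have hc : Continuous fun x => chi (-n) x * oddExt f x :=
    (continuous_chi _).mul (continuous_oddExt hf h0)
  rw [← intervalIntegral.integral_add_adjacent_intervals (b := 0) (hc.intervalIntegrable _ _)
    (hc.intervalIntegrable _ _)]
  have e1 : ∫ x in (-1:ℝ)..0, chi (-n) x * oddExt f x = ∫ x in (0:ℝ)..1, -(chi n x * f x) := by
    have h := intervalIntegral.integral_comp_neg (a := 0) (b := 1)
      (fun x => chi (-n) x * oddExt f x)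
    rw [neg_zero] at h
    rw [← h]
    refine intervalIntegral.integral_congr fun x hx => ?_
    rw [uIcc_of_le zero_le_one] at hx
    simp only [chi_neg_right, neg_neg]
    rcases hx.1.eq_or_lt with rfl | hx0
    · simp [oddExt, h0]
    · rw [oddExt, if_neg (by linarith), neg_neg, mul_neg]
  have e2 : ∫ x in (0:ℝ)..1, chi (-n) x * oddExt f x = ∫ x in (0:ℝ)..1, chi (-n) x * f x := by
    refine intervalIntegral.integral_congr fun x hx => ?_
    rw [uIcc_of_le zero_le_one] at hx
    simp only [oddExt, if_pos hx.1]
  have c1 : Continuous fun x => -(chi n x * f x) := ((continuous_chi _).mul hf).neg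
  have c2 : Continuous fun x => chi (-n) x * f x := (continuous_chi _).mul hf
  rw [e1, e2, ← intervalIntegral.integral_add (c1.intervalIntegrable _ _)
    (c2.intervalIntegrable _ _), sineCoeff, ← intervalIntegral.integral_const_mul]
  refine intervalIntegral.integral_congr fun x _ => ?_
  have hchi : chi n x - chi (-n) x = 2 * Complex.I * Real.sin (Real.pi * n * x) := by
    rw [chi, chi, Complex.ofReal_sin, Complex.sin]
    have : ((Real.pi * ((-n : ℤ) : ℝ) * x : ℝ) : ℂ) * Complex.I =
        -((Real.pi * n * x : ℝ) : ℂ) * Complex.I := by push_cast; ring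
    rw [this]
    linear_combination (Complex.exp (((Real.pi * n * x : ℝ) : ℂ) * Complex.I) -
      Complex.exp (-((Real.pi * n * x : ℝ) : ℂ) * Complex.I)) * Complex.I_sq
  linear_combination (-f x) * hchi

theorem exists_odd_fourier_series {Q : ℕ → ℝ → ℂ} (hc : Continuous (Q 0))
    (hQ : ∀ j, ∀ x ∈ Icc (0:ℝ) 1, HasDerivAt (Q j) (Q (j + 1) x) x)
    (h0 : ∀ j, Q (2 * j) 0 = 0) (h1 : ∀ j, Q (2 * j) 1 = 0) :
    ∃ a : Ell1, (∀ n, a (-n) = -a n) ∧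
      (∀ s : ℕ, Summable fun n : ℤ => (1 + |(n : ℝ)|) ^ s * ‖a n‖) ∧
      ∀ x ∈ Icc (0:ℝ) 1, four a x = Q 0 x := by
  set a : ℤ → ℂ := fun n => -Complex.I * sineCoeff (Q 0) n with ha
  have hodd : ∀ n, a (-n) = -a n := fun n => by
    simp only [ha, sineCoeff, ← intervalIntegral.integral_const_mul,
      ← intervalIntegral.integral_neg]
    refine intervalIntegral.integral_congr fun x _ => ?_
    simp
  have hrap : ∀ s : ℕ, Summable fun n : ℤ => (1 + |(n : ℝ)|) ^ s * ‖a n‖ := fun s => by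
    obtain ⟨B, hB⟩ := exists_weighted_sineCoeff_le hQ h0 h1 (s + 1)
    refine Summable.of_nonneg_of_le (fun n => by positivity) (fun n => ?_)
      (summable_one_add_abs_sq_inv.mul_left B)
    have hn : ‖a n‖ = ‖sineCoeff (Q 0) n‖ := by simp [ha]
    rw [← div_eq_mul_inv, le_div_iff₀ (by positivity), hn]
    refine le_trans ?_ (hB n)
    have h1' : 1 ≤ 1 + |(n : ℝ)| := by linarith [abs_nonneg (n : ℝ)]
    calc (1 + |(n : ℝ)|) ^ s * ‖sineCoeff (Q 0) n‖ * (1 + |(n : ℝ)|) ^ 2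
        = (1 + |(n : ℝ)|) ^ (s + 2) * ‖sineCoeff (Q 0) n‖ := by ring
      _ ≤ _ := by
        gcongr
        omega
  have hsum : Summable fun n => ‖a n‖ := by simpa using hrap 0
  refine ⟨Ell1.mk a hsum, hodd, hrap, fun x hx => ?_⟩
  change four a x = Q 0 x
  rcases hx.2.eq_or_lt with rfl | hx1
  · rw [four_one_of_odd hodd]; exact (h1 0).symm
  have : Fact ((0 : ℝ) < 2) := ⟨two_pos⟩
  have hq0 : Q 0 0 = 0 := h0 0
  have hq1 : Q 0 1 = 0 := h1 0
  have hcl : Continuous (AddCircle.liftIco (2 : ℝ) (-1) (oddExt (Q 0))) := by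
    refine AddCircle.liftIco_continuous ?_ (continuous_oddExt hc hq0).continuousOn
    norm_num [oddExt, hq1]
  set F : C(AddCircle (2 : ℝ), ℂ) := ⟨_, hcl⟩ with hF
  have hchi : ∀ (n : ℤ) (y : ℝ), fourier n (y : AddCircle (2 : ℝ)) = chi n y := fun n y => by
    rw [fourier_coe_apply, chi]; congr 1; push_cast; ring
  have hcoef : fourierCoeff F = a := by
    funext n
    have h := fourierCoeff_liftIco_eq (T := 2) (a := -1) (oddExt (Q 0)) n
    refine h.trans ?_
    rw [fourierCoeffOn_eq_integral]
    have hchi' : ∀ (T : ℝ) (y : ℝ), T = 2 → fourier (-n) (y : AddCircle T) = chi (-n) y := by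
      rintro T y rfl
      exact hchi _ y
    have hT : (-1 + 2 - -1 : ℝ) = 2 := by norm_num
    simp only [hchi' _ _ hT, smul_eq_mul]
    rw [show (-1 + 2 : ℝ) = 1 by norm_num, integral_chi_mul_oddExt hc hq0, Complex.real_smul]
    simp only [ha]
    push_cast
    ring
  have hps := has_pointwise_sum_fourier_series_of_summable (f := F)
    (by rw [hcoef]; exact hsum.of_norm) (x : AddCircle (2 : ℝ))
  rw [hcoef] at hps
  have hv : F (x : AddCircle (2 : ℝ)) = Q 0 x := by
    have := AddCircle.liftIco_coe_apply (p := (2 : ℝ)) (a := -1) (f := oddExt (Q 0)) (x := x)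
      ⟨by linarith [hx.1], by linarith⟩
    exact this.trans (if_pos hx.1)
  rw [hv] at hps
  simp only [hchi, smul_eq_mul] at hps
  exact hps.tsum_eq

/-- Global smooth solutions of the focusing cubic nonlinear Schrödinger equation on the unit
interval with Dirichlet boundary conditions. -/
theorem exists_global_nls {Q : ℕ → ℝ → ℂ} (hc : Continuous (Q 0))
    (hQ : ∀ j, ∀ x ∈ Icc (0:ℝ) 1, HasDerivAt (Q j) (Q (j + 1) x) x)
    (h0 : ∀ j, Q (2 * j) 0 = 0) (h1 : ∀ j, Q (2 * j) 1 = 0) :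
    ∃ q q' q'' : ℝ → ℝ → ℂ, ContDiff ℝ (⊤ : ℕ∞) (fun p : ℝ × ℝ => q p.1 p.2) ∧
      ContDiff ℝ (⊤ : ℕ∞) (fun p : ℝ × ℝ => q' p.1 p.2) ∧
      ContDiff ℝ (⊤ : ℕ∞) (fun p : ℝ × ℝ => q'' p.1 p.2) ∧
      (∀ x t, HasDerivAt (fun y => q y t) (q' x t) x) ∧
      (∀ x t, HasDerivAt (fun y => q' y t) (q'' x t) x) ∧
      (∀ x t, HasDerivAt (fun s => q x s)
        (Complex.I * q'' x t + Complex.I / 2 * (q x t * conj (q x t) * q x t)) t) ∧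
      (∀ t, q 0 t = 0 ∧ q 1 t = 0) ∧ ∀ x ∈ Icc (0:ℝ) 1, q x 0 = Q 0 x := by
  obtain ⟨a, hodd, hrap, ha⟩ := exists_odd_fourier_series hc hQ h0 h1
  obtain ⟨c, rfl, hd⟩ := Ell1.exists_global_sol a hodd hrap
  have hJ := Ell1.mem_Ioo_abs_add_one
  refine ⟨Ell1.fld c 0, Ell1.fld c 1, Ell1.fld c 2, Ell1.contDiff_fld hd hrap 0,
    Ell1.contDiff_fld hd hrap 1, Ell1.contDiff_fld hd hrap 2,
    fun x t => Ell1.hasDerivAt_fld (fun t _ => hd t) hrap 0 x (hJ t),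
    fun x t => Ell1.hasDerivAt_fld (fun t _ => hd t) hrap 1 x (hJ t), fun x t => ?_, fun t => ?_,
    fun x hx => ?_⟩
  · rw [← Ell1.cub_zero]
    exact Ell1.hasDerivAt_fld_time (fun t _ => hd t) hrap 0 x (hJ t)
  · exact Ell1.fld_zero_odd (Ell1.sol_odd (τ := |t| + 1) (fun t _ => hd t) hodd (lt_add_one _))
  · rw [← ha x hx]
    change four (Ell1.sol c 0) x = _
    have hs : Ell1.sol c 0 = c 0 := by
      ext n
      simp [Ell1.sol, Ell1.phase]
    rw [hs]

end SineSeries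

section CrossProduct

open scoped RealInnerProductSpace

theorem cross3_apply_zero (a b : E3) : cross3 a b 0 = a 1 * b 2 - a 2 * b 1 := by
  simp [cross3, cross_apply]

theorem cross3_apply_one (a b : E3) : cross3 a b 1 = a 2 * b 0 - a 0 * b 2 := by
  simp [cross3, cross_apply]

theorem cross3_apply_two (a b : E3) : cross3 a b 2 = a 0 * b 1 - a 1 * b 0 := by
  simp [cross3, cross_apply]

theorem inner_E3 (a b : E3) : ⟪a, b⟫ = a 0 * b 0 + a 1 * b 1 + a 2 * b 2 := by
  simp [PiLp.inner_apply, Fin.sum_univ_three, mul_comm]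

theorem E3.ext' {a b : E3} (h0 : a 0 = b 0) (h1 : a 1 = b 1) (h2 : a 2 = b 2) : a = b := by
  ext i; fin_cases i
  exacts [h0, h1, h2]

/-- The cross product as a continuous bilinear map. -/
def crossCLM : E3 →L[ℝ] E3 →L[ℝ] E3 :=
  LinearMap.toContinuousBilinearMap <| LinearMap.mk₂ ℝ cross3
    (fun a b c => E3.ext' (by simp [cross3_apply_zero]; ring) (by simp [cross3_apply_one]; ring)
      (by simp [cross3_apply_two]; ring))
    (fun r a b => E3.ext' (by simp [cross3_apply_zero]; ring) (by simp [cross3_apply_one]; ring)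
      (by simp [cross3_apply_two]; ring))
    (fun a b c => E3.ext' (by simp [cross3_apply_zero]; ring) (by simp [cross3_apply_one]; ring)
      (by simp [cross3_apply_two]; ring))
    (fun r a b => E3.ext' (by simp [cross3_apply_zero]; ring) (by simp [cross3_apply_one]; ring)
      (by simp [cross3_apply_two]; ring))

theorem crossCLM_apply (a b : E3) : crossCLM a b = cross3 a b := rfl

theorem cross3_add_right (a b c : E3) : cross3 a (b + c) = cross3 a b + cross3 a c :=
  map_add (crossCLM a) b c

theorem cross3_sub_right (a b c : E3) : cross3 a (b - c) = cross3 a b - cross3 a c :=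
  map_sub (crossCLM a) b c

theorem cross3_sub_left (a b c : E3) : cross3 (a - b) c = cross3 a c - cross3 b c :=
  crossCLM.map_sub₂ a b c

theorem cross3_add_left (a b c : E3) : cross3 (a + b) c = cross3 a c + cross3 b c :=
  crossCLM.map_add₂ a b c

theorem cross3_smul_right (r : ℝ) (a b : E3) : cross3 a (r • b) = r • cross3 a b :=
  map_smul (crossCLM a) r b

theorem cross3_smul_left (r : ℝ) (a b : E3) : cross3 (r • a) b = r • cross3 a b :=
  crossCLM.map_smul₂ r a b

theorem cross3_self (a : E3) : cross3 a a = 0 :=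
  E3.ext' (by simp [cross3_apply_zero]; ring) (by simp [cross3_apply_one]; ring)
      (by simp [cross3_apply_two]; ring)

theorem cross3_comm (a b : E3) : cross3 b a = -cross3 a b :=
  E3.ext' (by simp [cross3_apply_zero]; ring) (by simp [cross3_apply_one]; ring)
      (by simp [cross3_apply_two]; ring)

theorem cross3_cross3 (a b c : E3) : cross3 a (cross3 b c) = ⟪a, c⟫ • b - ⟪a, b⟫ • c := by
  refine E3.ext' ?_ ?_ ?_ <;>
    simp [cross3_apply_zero, cross3_apply_one, cross3_apply_two, inner_E3] <;> ring

theorem inner_cross3_left_eq (a b c : E3) : ⟪cross3 a b, c⟫ = ⟪a, cross3 b c⟫ := by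
  simp only [cross3_apply_zero, cross3_apply_one, cross3_apply_two, inner_E3]; ring

theorem inner_self_cross3 (a b : E3) : ⟪a, cross3 a b⟫ = 0 := by
  simp only [cross3_apply_zero, cross3_apply_one, cross3_apply_two, inner_E3]; ring

theorem norm_cross3_sq (a b : E3) : ‖cross3 a b‖ ^ 2 = ‖a‖ ^ 2 * ‖b‖ ^ 2 - ⟪a, b⟫ ^ 2 := by
  simp only [← real_inner_self_eq_norm_sq, cross3_apply_zero, cross3_apply_one, cross3_apply_two,
    inner_E3]
  ring

theorem norm_cross3_le (a b : E3) : ‖cross3 a b‖ ≤ ‖a‖ * ‖b‖ := by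
  refine le_of_sq_le_sq ?_ (by positivity)
  rw [norm_cross3_sq, mul_pow]
  linarith [sq_nonneg ⟪a, b⟫]

/-- Positively oriented orthonormal triples. -/
structure IsFrame (a b c : E3) : Prop where
  norm_fst : ‖a‖ = 1
  norm_snd : ‖b‖ = 1
  inner_eq : ⟪a, b⟫ = 0
  cross_eq : cross3 a b = c

namespace IsFrame

variable {a b c : E3}

theorem norm_trd (h : IsFrame a b c) : ‖c‖ = 1 := by
  have := norm_cross3_sq a b
  rw [h.cross_eq, h.norm_fst, h.norm_snd, h.inner_eq] at this
  have h2 : ‖c‖ ^ 2 = 1 := by rw [this]; norm_num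
  exact (pow_eq_one_iff_of_nonneg (norm_nonneg _) two_ne_zero).1 h2

theorem inner_fst_trd (h : IsFrame a b c) : ⟪a, c⟫ = 0 := by
  rw [← h.cross_eq, inner_self_cross3]

theorem cross_fst_trd (h : IsFrame a b c) : cross3 a c = -b := by
  rw [← h.cross_eq, cross3_cross3, h.inner_eq, real_inner_self_eq_norm_sq, h.norm_fst]
  simp

theorem cross_snd_trd (h : IsFrame a b c) : cross3 b c = a := by
  rw [← h.cross_eq, cross3_cross3, real_inner_comm a b, h.inner_eq, real_inner_self_eq_norm_sq,
    h.norm_snd]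
  simp

theorem eq_sum (h : IsFrame a b c) (v : E3) : v = ⟪v, a⟫ • a + ⟪v, b⟫ • b + ⟪v, c⟫ • c := by
  have h1 : cross3 c (cross3 c v) = ⟪c, v⟫ • c - v := by
    rw [cross3_cross3, real_inner_self_eq_norm_sq, h.norm_trd]; simp
  have h2 : cross3 c v = ⟪v, a⟫ • b - ⟪v, b⟫ • a := by
    rw [cross3_comm, ← h.cross_eq, cross3_cross3]; simp
  rw [h2, cross3_sub_right, cross3_smul_right, cross3_smul_right, cross3_comm b c, cross3_comm a c,
    h.cross_snd_trd, h.cross_fst_trd, real_inner_comm v c] at h1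
  rw [← sub_eq_zero, ← sub_eq_zero.2 h1]
  module

end IsFrame

theorem exists_isFrame {a : E3} (ha : ‖a‖ = 1) : ∃ b c, IsFrame a b c := by
  obtain ⟨w, hw⟩ : ∃ w : E3, cross3 a w ≠ 0 := by
    by_contra! h
    have : a = 0 := by
      have e : ∀ i, cross3 a (EuclideanSpace.single i 1) = 0 := fun i => h _
      have e0 := congrArg (fun v : E3 => v 1) (e 0)
      have e0' := congrArg (fun v : E3 => v 2) (e 0)
      have e1 := congrArg (fun v : E3 => v 2) (e 1)
      simp [cross3_apply_one, cross3_apply_two] at e0 e0' e1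
      exact E3.ext' e1 e0' e0
    simp [this] at ha
  refine ⟨‖cross3 a w‖⁻¹ • cross3 a w, _, ha, norm_smul_inv_norm hw, ?_, rfl⟩
  rw [inner_smul_right, inner_self_cross3, mul_zero]

theorem HasDerivAt.cross3 {f g : ℝ → E3} {f' g' : E3} {x : ℝ} (hf : HasDerivAt f f' x)
    (hg : HasDerivAt g g' x) :
    HasDerivAt (fun y => cross3 (f y) (g y)) (_root_.cross3 (f x) g' + _root_.cross3 f' (g x)) x :=
  crossCLM.hasDerivAt_of_bilinear (fun _ => hf) fun _ => hg

end CrossProduct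

section InitialFrame

open scoped RealInnerProductSpace

theorem contDiff_covIter {u₀ : ℝ → E3} (hsm : ContDiff ℝ (⊤ : ℕ∞) u₀) (j : ℕ) :
    ContDiff ℝ (⊤ : ℕ∞) (covIter u₀ j) := by
  induction j with
  | zero => exact (contDiff_infty_iff_deriv.1 hsm).2
  | succ j ih =>
    have h := (contDiff_infty_iff_deriv.1 ih).2
    exact h.sub ((h.inner ℝ hsm).smul hsm)

theorem inner_deriv_eq_zero_of_norm_eq_one {u₀ : ℝ → E3} (hsm : ContDiff ℝ (⊤ : ℕ∞) u₀)
    (hsph : ∀ x ∈ Icc (0:ℝ) 1, ‖u₀ x‖ = 1) : ∀ x ∈ Icc (0:ℝ) 1, ⟪deriv u₀ x, u₀ x⟫ = 0 := by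
  intro x hx
  have hd : HasDerivAt u₀ (deriv u₀ x) x := (hsm.differentiable (by simp) x).hasDerivAt
  have h1 := (hd.inner ℝ hd).hasDerivWithinAt (s := Icc 0 1)
  have h2 : HasDerivWithinAt (fun y => ⟪u₀ y, u₀ y⟫) 0 (Icc 0 1) x :=
    (hasDerivWithinAt_const x _ (1 : ℝ)).congr_of_mem
      (fun y hy => by rw [real_inner_self_eq_norm_sq, hsph y hy, one_pow]) hx
  have := (uniqueDiffOn_Icc zero_lt_one x hx).eq_deriv _ h1 h2
  rw [real_inner_comm] at this
  linarith

theorem inner_covIter {u₀ : ℝ → E3} (hsm : ContDiff ℝ (⊤ : ℕ∞) u₀)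
    (hsph : ∀ x ∈ Icc (0:ℝ) 1, ‖u₀ x‖ = 1) (j : ℕ) :
    ∀ x ∈ Icc (0:ℝ) 1, ⟪covIter u₀ j x, u₀ x⟫ = 0 := by
  intro x hx
  cases j with
  | zero => exact inner_deriv_eq_zero_of_norm_eq_one hsm hsph x hx
  | succ j =>
    change ⟪deriv (covIter u₀ j) x - ⟪deriv (covIter u₀ j) x, u₀ x⟫ • u₀ x, u₀ x⟫ = 0
    rw [inner_sub_left, real_inner_smul_left, real_inner_self_eq_norm_sq, hsph x hx]
    ring

theorem eq_left_of_hasDerivAt_zero {f : ℝ → ℝ} {f' : ℝ → ℝ} {T : ℝ}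
    (hf : ∀ x ∈ Icc 0 T, HasDerivAt f (f' x) x) (h0 : ∀ x ∈ Icc 0 T, f' x = 0) :
    ∀ x ∈ Icc 0 T, f x = f 0 :=
  constant_of_has_deriv_right_zero (fun x hx => (hf x hx).continuousAt.continuousWithinAt)
    fun x hx => by
      have hx' := Ico_subset_Icc_self hx
      rw [← h0 x hx']
      exact (hf x hx').hasDerivWithinAt

theorem exists_parallel_frame {u₀ : ℝ → E3} (hsm : ContDiff ℝ (⊤ : ℕ∞) u₀)
    (hsph : ∀ x ∈ Icc (0:ℝ) 1, ‖u₀ x‖ = 1) :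
    ∃ e₁ e₂ : ℝ → E3, Continuous e₁ ∧ Continuous e₂ ∧
      (∀ x ∈ Icc (0:ℝ) 1, IsFrame (u₀ x) (e₁ x) (e₂ x)) ∧
      (∀ x ∈ Icc (0:ℝ) 1, HasDerivAt e₁ (-(⟪deriv u₀ x, e₁ x⟫ • u₀ x)) x) ∧
      (∀ x ∈ Icc (0:ℝ) 1, HasDerivAt e₂ (-(⟪deriv u₀ x, e₂ x⟫ • u₀ x)) x) := by
  have h01 : (0:ℝ) ∈ Icc (0:ℝ) 1 := left_mem_Icc.2 zero_le_one
  obtain ⟨b, c, hbc⟩ := exists_isFrame (hsph 0 h01)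
  have hdc : Continuous (deriv u₀) := (contDiff_infty_iff_deriv.1 hsm).2.continuous
  have hc := hsm.continuous
  have hd : ∀ x, HasDerivAt u₀ (deriv u₀ x) x :=
    fun x => (hsm.differentiable (by simp) x).hasDerivAt
  have hperp := inner_deriv_eq_zero_of_norm_eq_one hsm hsph
  obtain ⟨e, he0, he⟩ := exists_linear_ode
    (A := fun x => -((innerSL ℝ (deriv u₀ x)).smulRight (u₀ x))) (by fun_prop) b
  simp only [neg_apply, ContinuousLinearMap.smulRight_apply,
    innerSL_apply_apply] at he
  have hue : ∀ x ∈ Icc (0:ℝ) 1, ⟪u₀ x, e x⟫ = 0 := by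
    intro x hx
    rw [eq_left_of_hasDerivAt_zero (fun y _ => (hd y).inner ℝ (he y)) (fun y hy => ?_) x hx,
      he0, hbc.inner_eq]
    rw [inner_neg_right, real_inner_smul_right, real_inner_self_eq_norm_sq, hsph y hy]
    ring
  have hee : ∀ x ∈ Icc (0:ℝ) 1, ‖e x‖ = 1 := by
    intro x hx
    have : ⟪e x, e x⟫ = 1 := by
      rw [eq_left_of_hasDerivAt_zero (fun y _ => (he y).inner ℝ (he y)) (fun y hy => ?_) x hx,
        he0, real_inner_self_eq_norm_sq, hbc.norm_snd, one_pow]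
      rw [inner_neg_right, inner_neg_left, real_inner_smul_right, real_inner_smul_left,
        real_inner_comm (u₀ y) (e y), hue y hy]
      ring
    rw [real_inner_self_eq_norm_sq] at this
    exact (pow_eq_one_iff_of_nonneg (norm_nonneg _) two_ne_zero).1 this
  have hfr : ∀ x ∈ Icc (0:ℝ) 1, IsFrame (u₀ x) (e x) (cross3 (u₀ x) (e x)) :=
    fun x hx => ⟨hsph x hx, hee x hx, hue x hx, rfl⟩
  have hec : Continuous e := continuous_iff_continuousAt.2 fun x => (he x).continuousAt
  refine ⟨e, fun x => cross3 (u₀ x) (e x), hec, (crossCLM.continuous.comp hc).clm_apply hec, hfr,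
    fun x _ => he x, fun x hx => ?_⟩
  refine ((hd x).cross3 (he x)).congr_deriv ?_
  have hf := hfr x hx
  have h3 : cross3 (cross3 (u₀ x) (e x)) (e x) = -u₀ x := by
    rw [cross3_comm, hf.cross_snd_trd]
  have hs := hf.eq_sum (deriv u₀ x)
  rw [hperp x hx, zero_smul, zero_add] at hs
  rw [← smul_neg (⟪deriv u₀ x, cross3 (u₀ x) (e x)⟫), ← h3, ← neg_smul, cross3_smul_right,
    cross3_self, smul_zero, zero_add]
  conv_lhs => rw [hs]
  rw [cross3_add_left, cross3_smul_left, cross3_smul_left, cross3_self, smul_zero, zero_add]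

/-- The complex coordinates of the iterated covariant derivatives in a parallel frame. -/
def frameCoord (u₀ e₁ e₂ : ℝ → E3) (j : ℕ) (x : ℝ) : ℂ :=
  ⟪covIter u₀ j x, e₁ x⟫ + ⟪covIter u₀ j x, e₂ x⟫ * Complex.I

theorem hasDerivAt_inner_covIter {u₀ e : ℝ → E3} (hsm : ContDiff ℝ (⊤ : ℕ∞) u₀)
    (hsph : ∀ x ∈ Icc (0:ℝ) 1, ‖u₀ x‖ = 1) {x : ℝ} (hx : x ∈ Icc (0:ℝ) 1)
    (hue : ⟪u₀ x, e x⟫ = 0) (he : HasDerivAt e (-(⟪deriv u₀ x, e x⟫ • u₀ x)) x) (j : ℕ) :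
    HasDerivAt (fun y => ⟪covIter u₀ j y, e y⟫) ⟪covIter u₀ (j + 1) x, e x⟫ x := by
  have hd := ((contDiff_covIter hsm j).differentiable (by simp) x).hasDerivAt
  refine (hd.inner ℝ he).congr_deriv ?_
  change _ = ⟪deriv (covIter u₀ j) x - ⟪deriv (covIter u₀ j) x, u₀ x⟫ • u₀ x, e x⟫
  rw [inner_neg_right, real_inner_smul_right, inner_sub_left, real_inner_smul_left, hue,
    inner_covIter hsm hsph j x hx]
  ring

end InitialFrame

section FrameEvolution

open scoped RealInnerProductSpace

theorem crossCLM_mul_sub_mul (a b : E3) :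
    crossCLM a * crossCLM b - crossCLM b * crossCLM a = crossCLM (cross3 a b) := by
  ext1 v
  change cross3 a (cross3 b v) - cross3 b (cross3 a v) = cross3 (cross3 a b) v
  rw [cross3_cross3, cross3_cross3, cross3_comm v, cross3_cross3, real_inner_comm a b,
    real_inner_comm v a, real_inner_comm v b]
  module

theorem star_crossCLM (a : E3) : star (crossCLM a) = -crossCLM a := by
  rw [ContinuousLinearMap.star_eq_adjoint, eq_comm, ContinuousLinearMap.eq_adjoint_iff]
  intro v w
  rw [neg_apply, crossCLM_apply, crossCLM_apply, ← cross3_comm, inner_cross3_left_eq]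

theorem mul_star_const_of_hasDerivAt {F : ℝ → E3 →L[ℝ] E3} {w : ℝ → E3}
    (hF : ∀ x, HasDerivAt F (F x * crossCLM (w x)) x) (x : ℝ) :
    F x * star (F x) = F 0 * star (F 0) := by
  have h : ∀ x, HasDerivAt (fun y => F y * star (F y)) 0 x := fun x => by
    refine ((hF x).mul (hF x).star).congr_deriv ?_
    have h : -crossCLM (w x) * star (F x) = -(crossCLM (w x) * star (F x)) := by ext1 v; rfl
    have h' : F x * -(crossCLM (w x) * star (F x)) = -(F x * (crossCLM (w x) * star (F x))) := by
      ext1 v; exact map_neg (F x) _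
    rw [star_mul, star_crossCLM, mul_assoc, h, h', add_neg_cancel]
  exact is_const_of_deriv_eq_zero (fun x => (h x).differentiableAt) (fun x => (h x).deriv) x 0

theorem triple_product_const {u e₁ e₂ : ℝ → E3} {r s α : ℝ → ℝ}
    (hu : ∀ x, HasDerivAt u (r x • e₁ x + s x • e₂ x) x)
    (h₁ : ∀ x, HasDerivAt e₁ (-(r x • u x) + α x • e₂ x) x)
    (h₂ : ∀ x, HasDerivAt e₂ (-(s x • u x) - α x • e₁ x) x) (x : ℝ) :
    ⟪cross3 (u x) (e₁ x), e₂ x⟫ = ⟪cross3 (u 0) (e₁ 0), e₂ 0⟫ := by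
  have h : ∀ x, HasDerivAt (fun y => ⟪cross3 (u y) (e₁ y), e₂ y⟫) 0 x := fun x => by
    refine (((hu x).cross3 (h₁ x)).inner ℝ (h₂ x)).congr_deriv ?_
    simp only [cross3_apply_zero, cross3_apply_one, cross3_apply_two, inner_E3, PiLp.add_apply,
      PiLp.sub_apply, PiLp.neg_apply, PiLp.smul_apply, smul_eq_mul]
    ring
  exact is_const_of_deriv_eq_zero (fun x => (h x).differentiableAt) (fun x => (h x).deriv) x 0

theorem isFrame_of_triple_product {a b c : E3} (ha : ‖a‖ = 1) (hb : ‖b‖ = 1) (hc : ‖c‖ = 1)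
    (hab : ⟪a, b⟫ = 0) (h : ⟪cross3 a b, c⟫ = 1) : IsFrame a b c := by
  refine ⟨ha, hb, hab, ?_⟩
  have h1 := norm_sub_sq_real (cross3 a b) c
  rw [h, norm_cross3_sq, ha, hb, hc, hab] at h1
  have : ‖cross3 a b - c‖ = 0 := by
    refine pow_eq_zero_iff two_ne_zero |>.1 ?_
    rw [h1]; norm_num
  exact sub_eq_zero.1 (norm_eq_zero.1 this)

/-- A solution of the focusing cubic nonlinear Schrödinger equation is the curvature of a moving
frame whose first vector evolves by the Schrödinger flow. -/
theorem exists_frame_of_nls {q q' q'' : ℝ → ℝ → ℂ}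
    (hq : ContDiff ℝ (⊤ : ℕ∞) (fun p : ℝ × ℝ => q p.1 p.2))
    (hq' : ContDiff ℝ (⊤ : ℕ∞) (fun p : ℝ × ℝ => q' p.1 p.2))
    (hq'' : ContDiff ℝ (⊤ : ℕ∞) (fun p : ℝ × ℝ => q'' p.1 p.2))
    (hx : ∀ x t, HasDerivAt (fun y => q y t) (q' x t) x)
    (hxx : ∀ x t, HasDerivAt (fun y => q' y t) (q'' x t) x)
    (ht : ∀ x t, HasDerivAt (fun s => q x s)
      (Complex.I * q'' x t + Complex.I / 2 * (q x t * starRingEnd ℂ (q x t) * q x t)) t)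
    {a b c : E3} (habc : IsFrame a b c) :
    ∃ u e₁ e₂ : ℝ → ℝ → E3, ContDiff ℝ (⊤ : ℕ∞) (fun p : ℝ × ℝ => u p.1 p.2) ∧
      (u 0 0 = a ∧ e₁ 0 0 = b ∧ e₂ 0 0 = c) ∧ (∀ x t, IsFrame (u x t) (e₁ x t) (e₂ x t)) ∧
      (∀ x t, HasDerivAt (fun y => u y t) ((q x t).re • e₁ x t + (q x t).im • e₂ x t) x) ∧
      (∀ x t, HasDerivAt (fun y => e₁ y t) (-((q x t).re • u x t)) x) ∧
      (∀ x t, HasDerivAt (fun y => e₂ y t) (-((q x t).im • u x t)) x) ∧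
      (∀ x t, HasDerivAt (fun s => u x s) (-(q' x t).im • e₁ x t + (q' x t).re • e₂ x t) t) := by
  have hre : ∀ {f : ℝ → ℂ} {f' : ℂ} {y : ℝ}, HasDerivAt f f' y →
      HasDerivAt (fun z => (f z).re) f'.re y := fun h => Complex.reCLM.hasFDerivAt.comp_hasDerivAt _ h
  have him : ∀ {f : ℝ → ℂ} {f' : ℂ} {y : ℝ}, HasDerivAt f f' y →
      HasDerivAt (fun z => (f z).im) f'.im y := fun h => Complex.imCLM.hasFDerivAt.comp_hasDerivAt _ h
  have cre : ∀ {f : ℝ × ℝ → ℂ}, ContDiff ℝ (⊤ : ℕ∞) f → ContDiff ℝ (⊤ : ℕ∞) fun p => (f p).re :=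
    fun h => Complex.reCLM.contDiff.comp h
  have cim : ∀ {f : ℝ × ℝ → ℂ}, ContDiff ℝ (⊤ : ℕ∞) f → ContDiff ℝ (⊤ : ℕ∞) fun p => (f p).im :=
    fun h => Complex.imCLM.contDiff.comp h
  set ω : ℝ → ℝ → E3 := fun x t => (q x t).re • c - (q x t).im • b with hω
  set α : ℝ → ℝ → ℝ := fun x t => -(((q x t).re * (q x t).re + (q x t).im * (q x t).im) / 2) with hα
  set ν : ℝ → ℝ → E3 := fun x t => α x t • a - (q' x t).re • b - (q' x t).im • c with hν
  set νx : ℝ → ℝ → E3 := fun x t =>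
    (-((q x t).re * (q' x t).re + (q x t).im * (q' x t).im)) • a - (q'' x t).re • b
      - (q'' x t).im • c with hνx
  have hωc : ContDiff ℝ (⊤ : ℕ∞) (fun p : ℝ × ℝ => ω p.1 p.2) :=
    ((cre hq).smul contDiff_const).sub ((cim hq).smul contDiff_const)
  have hνc : ContDiff ℝ (⊤ : ℕ∞) (fun p : ℝ × ℝ => ν p.1 p.2) :=
    ((((((cre hq).mul (cre hq)).add ((cim hq).mul (cim hq))).div_const 2).neg.smul
      contDiff_const).sub ((cre hq').smul contDiff_const)).sub ((cim hq').smul contDiff_const)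
  have hνxc : Continuous (fun p : ℝ × ℝ => νx p.1 p.2) :=
    (((((((cre hq).mul (cre hq')).add ((cim hq).mul (cim hq'))).neg.smul
      contDiff_const).sub ((cre hq'').smul contDiff_const)).sub
        ((cim hq'').smul contDiff_const)) : ContDiff ℝ (⊤ : ℕ∞) _).continuous
  have hba : cross3 b a = -c := by rw [cross3_comm, habc.cross_eq]
  have hca : cross3 c a = b := by rw [cross3_comm, habc.cross_fst_trd, neg_neg]
  have hcb : cross3 c b = -a := by rw [cross3_comm, habc.cross_snd_trd]
  obtain ⟨F, hFc, hF0, hFx, hFt⟩ := exists_frame_of_zero_curvature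
    (U := fun p => crossCLM (ω p.1 p.2)) (V := fun p => crossCLM (ν p.1 p.2))
    (Vx := fun p => crossCLM (νx p.1 p.2)) (crossCLM.contDiff.comp hωc)
    (crossCLM.contDiff.comp hνc) (crossCLM.continuous.comp hνxc)
    (fun x t => crossCLM.hasFDerivAt.comp_hasDerivAt x <| by
      have h1 := hre (hx x t)
      have h2 := him (hx x t)
      refine (((((h1.mul h1).add (h2.mul h2)).div_const 2).neg.smul_const a).sub
        ((hre (hxx x t)).smul_const b)).sub ((him (hxx x t)).smul_const c) |>.congr_deriv ?_
      simp only [hνx]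
      module)
    (fun x t => by
      dsimp only
      rw [add_sub_assoc, crossCLM_mul_sub_mul, ← map_add]
      refine crossCLM.hasFDerivAt.comp_hasDerivAt t ?_
      refine (((hre (ht x t)).smul_const c).sub ((him (ht x t)).smul_const b)).congr_deriv ?_
      simp only [hνx, hω, hν, hα, cross3_sub_left, cross3_sub_right, cross3_smul_left,
        cross3_smul_right, cross3_self, hba, hca, hcb, habc.cross_snd_trd]
      simp
      module)
    1
  have hstar : ∀ x t, F (x, t) * star (F (x, t)) = 1 := fun x t => by
    rw [mul_star_const_of_hasDerivAt (fun x => hFx x t) x,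
      mul_star_const_of_hasDerivAt (fun t => hFt 0 t) t, hF0, star_one, mul_one]
  have hinner : ∀ x t v w, ⟪F (x, t) v, F (x, t) w⟫ = ⟪v, w⟫ := fun x t v w => by
    have : star (F (x, t)) * F (x, t) = 1 := by
      have h : (F (x, t) : E3 →ₗ[ℝ] E3) * (star (F (x, t)) : E3 →L[ℝ] E3) = 1 :=
        congrArg ContinuousLinearMap.toLinearMap (hstar x t)
      exact ContinuousLinearMap.coe_injective (mul_eq_one_comm.1 h)
    rw [← ContinuousLinearMap.adjoint_inner_right, ← ContinuousLinearMap.star_eq_adjoint]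
    exact congrArg (fun A : E3 →L[ℝ] E3 => ⟪v, A w⟫) this
  have hnorm : ∀ x t v, ‖F (x, t) v‖ = ‖v‖ := fun x t v => by
    rw [norm_eq_sqrt_real_inner, hinner, ← norm_eq_sqrt_real_inner]
  have dx : ∀ x t v, HasDerivAt (fun y => F (y, t) v) (F (x, t) (cross3 (ω x t) v)) x :=
    fun x t v => by simpa [crossCLM_apply] using (hFx x t).clm_apply (hasDerivAt_const x v)
  have dt : ∀ x t v, HasDerivAt (fun s => F (x, s) v) (F (x, t) (cross3 (ν x t) v)) t :=
    fun x t v => by simpa [crossCLM_apply] using (hFt x t).clm_apply (hasDerivAt_const t v)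
  have ωa : ∀ x t, cross3 (ω x t) a = (q x t).re • b + (q x t).im • c := fun x t => by
    simp only [hω, cross3_sub_left, cross3_smul_left, hca, hba]; module
  have ωb : ∀ x t, cross3 (ω x t) b = -((q x t).re • a) := fun x t => by
    simp only [hω, cross3_sub_left, cross3_smul_left, hcb, cross3_self]; module
  have ωc : ∀ x t, cross3 (ω x t) c = -((q x t).im • a) := fun x t => by
    simp only [hω, cross3_sub_left, cross3_smul_left, habc.cross_snd_trd, cross3_self]; module
  have νa : ∀ x t, cross3 (ν x t) a = (-(q' x t).im) • b + (q' x t).re • c := fun x t => by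
    simp only [hν, cross3_sub_left, cross3_smul_left, hca, hba, cross3_self]; module
  have νb : ∀ x t, cross3 (ν x t) b = -((-(q' x t).im) • a) + α x t • c := fun x t => by
    simp only [hν, cross3_sub_left, cross3_smul_left, hcb, habc.cross_eq, cross3_self]; module
  have νc : ∀ x t, cross3 (ν x t) c = -((q' x t).re • a) - α x t • b := fun x t => by
    simp only [hν, cross3_sub_left, cross3_smul_left, habc.cross_snd_trd, habc.cross_fst_trd,
      cross3_self]
    module
  have xa : ∀ x t, HasDerivAt (fun y => F (y, t) a)
      ((q x t).re • F (x, t) b + (q x t).im • F (x, t) c) x := fun x t => by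
    simpa [ωa] using dx x t a
  have xb : ∀ x t, HasDerivAt (fun y => F (y, t) b) (-((q x t).re • F (x, t) a)) x :=
    fun x t => by simpa [ωb] using dx x t b
  have xc : ∀ x t, HasDerivAt (fun y => F (y, t) c) (-((q x t).im • F (x, t) a)) x :=
    fun x t => by simpa [ωc] using dx x t c
  have ta : ∀ x t, HasDerivAt (fun s => F (x, s) a)
      (-(q' x t).im • F (x, t) b + (q' x t).re • F (x, t) c) t := fun x t => by
    have := dt x t a
    rwa [νa, map_add, map_smul, map_smul] at this
  have hfr : ∀ x t, IsFrame (F (x, t) a) (F (x, t) b) (F (x, t) c) := fun x t => by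
    refine isFrame_of_triple_product (by rw [hnorm, habc.norm_fst]) (by rw [hnorm, habc.norm_snd])
      (by rw [hnorm, habc.norm_trd]) (by rw [hinner, habc.inner_eq]) ?_
    rw [triple_product_const (u := fun x => F (x, t) a) (e₁ := fun x => F (x, t) b)
      (e₂ := fun x => F (x, t) c) (α := fun _ => 0) (fun x => xa x t)
      (fun x => by simpa using xb x t) (fun x => by simpa using xc x t) x,
      triple_product_const (u := fun t => F (0, t) a) (e₁ := fun t => F (0, t) b)
      (e₂ := fun t => F (0, t) c) (α := fun t => α 0 t) (fun t => ta 0 t)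
      (fun t => by simpa [νb] using dt 0 t b) (fun t => by simpa [νc] using dt 0 t c) t, hF0]
    simp only [one_apply_eq_self]
    rw [habc.cross_eq, real_inner_self_eq_norm_sq, habc.norm_trd, one_pow]
  exact ⟨fun x t => F (x, t) a, fun x t => F (x, t) b, fun x t => F (x, t) c,
    hFc.clm_apply contDiff_const, by simp [hF0], hfr, xa, xb, xc, ta⟩

end FrameEvolution

section Existence

open scoped RealInnerProductSpace

theorem exists_isGlobalSol {u₀ : ℝ → E3} (hsm : ContDiff ℝ (⊤ : ℕ∞) u₀)
    (hsph : ∀ x ∈ Icc (0:ℝ) 1, ‖u₀ x‖ = 1) (hcc : ∀ k : ℕ, CC u₀ k) :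
    ∃ u : ℝ → ℝ → E3, IsGlobalSol u ∧ ∀ x ∈ Icc (0:ℝ) 1, u x 0 = u₀ x := by
  obtain ⟨e₁, e₂, hc₁, hc₂, hfr, he₁, he₂⟩ := exists_parallel_frame hsm hsph
  have hzero : ∀ j y, covIter u₀ j y = 0 → frameCoord u₀ e₁ e₂ j y = 0 := fun j y h => by
    simp [frameCoord, h]
  obtain ⟨q, q', q'', hq, hq', hq'', hqx, hqxx, hqt, hqb, hq0⟩ :=
    exists_global_nls (Q := frameCoord u₀ e₁ e₂)
      (by
        have h := (contDiff_covIter hsm 0).continuous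
        exact (Complex.continuous_ofReal.comp (h.inner hc₁)).add
          ((Complex.continuous_ofReal.comp (h.inner hc₂)).mul continuous_const))
      (fun j x hx => by
        have h₁ := hasDerivAt_inner_covIter hsm hsph hx (hfr x hx).inner_eq (he₁ x hx) j
        have h₂ := hasDerivAt_inner_covIter hsm hsph hx (hfr x hx).inner_fst_trd (he₂ x hx) j
        exact h₁.ofReal_comp.add (h₂.ofReal_comp.mul_const _))
      (fun j => hzero _ _ (hcc j j le_rfl).1) (fun j => hzero _ _ (hcc j j le_rfl).2)
  obtain ⟨u, v, w, hu, ⟨hu0, hv0, hw0⟩, hF, hux, hvx, hwx, hut⟩ :=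
    exists_frame_of_nls hq hq' hq'' hqx hqxx hqt (hfr 0 (left_mem_Icc.2 zero_le_one))
  have hpdx : pdx u = fun x t => (q x t).re • v x t + (q x t).im • w x t := by
    funext x t; exact (hux x t).deriv
  refine ⟨u, ⟨hu, fun x _ t _ => (hF x t).norm_fst, fun x _ t _ => ?_, fun t _ => ?_⟩,
    fun x hx => ?_⟩
  · have hre : HasDerivAt (fun y => (q y t).re) (q' x t).re x :=
      Complex.reCLM.hasFDerivAt.comp_hasDerivAt _ (hqx x t)
    have him : HasDerivAt (fun y => (q y t).im) (q' x t).im x :=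
      Complex.imCLM.hasFDerivAt.comp_hasDerivAt _ (hqx x t)
    have hd : pdx (pdx u) x t =
        (q x t).re • -((q x t).re • u x t) + (q' x t).re • v x t +
          ((q x t).im • -((q x t).im • u x t) + (q' x t).im • w x t) := by
      rw [hpdx]
      exact ((hre.smul (hvx x t)).add (him.smul (hwx x t))).deriv
    have hd' : pdt u x t = _ := (hut x t).deriv
    rw [hd', hd]
    have h := hF x t
    simp only [cross3_add_right, cross3_smul_right, ← smul_neg, h.cross_eq, h.cross_fst_trd]
    simp only [← neg_one_smul ℝ (u x t), cross3_smul_right, cross3_self]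
    module
  · simp [hpdx, (hqb t).1, (hqb t).2]
  · have hd : ∀ y, HasDerivAt u₀ (deriv u₀ y) y :=
      fun y => (hsm.differentiable (by simp) y).hasDerivAt
    have hsum := eq_left_of_hasDerivAt_zero (T := 1)
      (fun y hy => (((hux y 0).inner ℝ (hd y)).add ((hvx y 0).inner ℝ (he₁ y hy))).add
        ((hwx y 0).inner ℝ (he₂ y hy))) (fun y hy => by
        have hs := (hfr y hy).eq_sum (deriv u₀ y)
        rw [inner_deriv_eq_zero_of_norm_eq_one hsm hsph y hy, zero_smul, zero_add] at hs
        have h1 : (q y 0).re = ⟪deriv u₀ y, e₁ y⟫ := by simp [hq0 y hy, frameCoord, covIter]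
        have h2 : (q y 0).im = ⟪deriv u₀ y, e₂ y⟫ := by simp [hq0 y hy, frameCoord, covIter]
        rw [h1, h2]
        generalize ⟪deriv u₀ y, e₁ y⟫ = r at *
        generalize ⟪deriv u₀ y, e₂ y⟫ = s at *
        rw [hs]
        simp only [inner_add_left, inner_add_right, inner_neg_left, inner_neg_right,
          real_inner_smul_left, real_inner_smul_right]
        ring) x hx
    have h0 := hfr 0 (left_mem_Icc.2 zero_le_one)
    have hx' := hfr x hx
    have hFx := hF x 0
    simp only [Pi.add_apply, hu0, hv0, hw0, real_inner_self_eq_norm_sq, h0.norm_fst, h0.norm_snd, h0.norm_trd]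
      at hsum
    have b1 := real_inner_le_norm (u x 0) (u₀ x)
    have b2 := real_inner_le_norm (v x 0) (e₁ x)
    have b3 := real_inner_le_norm (w x 0) (e₂ x)
    rw [hx'.norm_fst, hFx.norm_fst] at b1
    rw [hx'.norm_snd, hFx.norm_snd] at b2
    rw [hx'.norm_trd, hFx.norm_trd] at b3
    exact (inner_eq_one_iff_of_norm_eq_one (𝕜 := ℝ) hFx.norm_fst hx'.norm_fst).1 (by linarith)

end Existence

section PartialDerivatives

variable {f : ℝ → ℝ → E3}

theorem hasDerivAt_fst_of_contDiff (hf : ContDiff ℝ (⊤ : ℕ∞) fun p : ℝ × ℝ => f p.1 p.2)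
    (x t : ℝ) :
    HasDerivAt (fun y => f y t) (fderiv ℝ (fun p : ℝ × ℝ => f p.1 p.2) (x, t) (1, 0)) x :=
  (hf.differentiable (by simp) (x, t)).hasFDerivAt.comp_hasDerivAt (f := fun y : ℝ => (y, t)) x
    ((hasDerivAt_id x).prodMk (hasDerivAt_const x t))

theorem hasDerivAt_snd_of_contDiff (hf : ContDiff ℝ (⊤ : ℕ∞) fun p : ℝ × ℝ => f p.1 p.2)
    (x t : ℝ) :
    HasDerivAt (fun s => f x s) (fderiv ℝ (fun p : ℝ × ℝ => f p.1 p.2) (x, t) (0, 1)) t :=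
  (hf.differentiable (by simp) (x, t)).hasFDerivAt.comp_hasDerivAt (f := fun s : ℝ => (x, s)) t
    ((hasDerivAt_const t x).prodMk (hasDerivAt_id t))

theorem hasDerivAt_pdx (hf : ContDiff ℝ (⊤ : ℕ∞) fun p : ℝ × ℝ => f p.1 p.2) (x t : ℝ) :
    HasDerivAt (fun y => f y t) (pdx f x t) x :=
  (hasDerivAt_fst_of_contDiff hf x t).differentiableAt.hasDerivAt

theorem hasDerivAt_pdt (hf : ContDiff ℝ (⊤ : ℕ∞) fun p : ℝ × ℝ => f p.1 p.2) (x t : ℝ) :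
    HasDerivAt (fun s => f x s) (pdt f x t) t :=
  (hasDerivAt_snd_of_contDiff hf x t).differentiableAt.hasDerivAt

theorem pdx_eq_fderiv (hf : ContDiff ℝ (⊤ : ℕ∞) fun p : ℝ × ℝ => f p.1 p.2) (p : ℝ × ℝ) :
    pdx f p.1 p.2 = fderiv ℝ (fun p : ℝ × ℝ => f p.1 p.2) p (1, 0) :=
  (hasDerivAt_fst_of_contDiff hf p.1 p.2).deriv

theorem pdt_eq_fderiv (hf : ContDiff ℝ (⊤ : ℕ∞) fun p : ℝ × ℝ => f p.1 p.2) (p : ℝ × ℝ) :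
    pdt f p.1 p.2 = fderiv ℝ (fun p : ℝ × ℝ => f p.1 p.2) p (0, 1) :=
  (hasDerivAt_snd_of_contDiff hf p.1 p.2).deriv

theorem contDiff_pdx (hf : ContDiff ℝ (⊤ : ℕ∞) fun p : ℝ × ℝ => f p.1 p.2) :
    ContDiff ℝ (⊤ : ℕ∞) fun p : ℝ × ℝ => pdx f p.1 p.2 := by
  simp only [pdx_eq_fderiv hf]
  exact (hf.fderiv_right (m := (⊤ : ℕ∞)) (by simp)).clm_apply contDiff_const

theorem contDiff_pdt (hf : ContDiff ℝ (⊤ : ℕ∞) fun p : ℝ × ℝ => f p.1 p.2) :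
    ContDiff ℝ (⊤ : ℕ∞) fun p : ℝ × ℝ => pdt f p.1 p.2 := by
  simp only [pdt_eq_fderiv hf]
  exact (hf.fderiv_right (m := (⊤ : ℕ∞)) (by simp)).clm_apply contDiff_const

theorem pdt_pdx (hf : ContDiff ℝ (⊤ : ℕ∞) fun p : ℝ × ℝ => f p.1 p.2) (x t : ℝ) :
    pdt (pdx f) x t = pdx (pdt f) x t := by
  have hd : DifferentiableAt ℝ (fderiv ℝ fun p : ℝ × ℝ => f p.1 p.2) (x, t) :=
    ((hf.fderiv_right (m := (⊤ : ℕ∞)) (by simp)).differentiable (by simp)) _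
  rw [pdt_eq_fderiv (contDiff_pdx hf) (x, t), pdx_eq_fderiv (contDiff_pdt hf) (x, t)]
  simp only [pdx_eq_fderiv hf, pdt_eq_fderiv hf]
  rw [fderiv_clm_apply hd (differentiableAt_const _), fderiv_clm_apply hd (differentiableAt_const _)]
  simp only [fderiv_fun_const, Pi.zero_apply, ContinuousLinearMap.comp_zero, zero_add,
    ContinuousLinearMap.flip_apply]
  exact (hf.contDiffAt.isSymmSndFDerivAt (by simpa using WithTop.coe_le_coe.2 (le_top : (2 : ℕ∞) ≤ ⊤))) _ _

end PartialDerivatives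

section Uniqueness

open scoped RealInnerProductSpace

theorem IsGlobalSol.eq_of_eq_zero_time {u v : ℝ → ℝ → E3} (hu : IsGlobalSol u)
    (hv : IsGlobalSol v) (h0 : ∀ x ∈ Icc (0:ℝ) 1, v x 0 = u x 0) :
    ∀ x ∈ Icc (0:ℝ) 1, ∀ t ∈ Ici (0:ℝ), v x t = u x t := by
  obtain ⟨huc, -, hut, hub⟩ := hu
  obtain ⟨hvc, -, hvt, hvb⟩ := hv
  have h01 : (0:ℝ) ≤ 1 := zero_le_one
  set w : ℝ → ℝ → E3 := fun x t => v x t - u x t with hw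
  have hwc : ContDiff ℝ (⊤ : ℕ∞) fun p : ℝ × ℝ => w p.1 p.2 := hvc.sub huc
  have hwxc := contDiff_pdx hwc
  have hwtc := contDiff_pdt hwc
  have hwx : pdx w = fun x t => pdx v x t - pdx u x t := by
    funext x t; exact ((hasDerivAt_pdx hvc x t).sub (hasDerivAt_pdx huc x t)).deriv
  have hwxx : ∀ x t, pdx (pdx w) x t = pdx (pdx v) x t - pdx (pdx u) x t := fun x t => by
    rw [hwx]
    exact ((hasDerivAt_pdx (contDiff_pdx hvc) x t).sub
      (hasDerivAt_pdx (contDiff_pdx huc) x t)).deriv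
  have hwb : ∀ t ∈ Ici (0:ℝ), pdx w 0 t = 0 ∧ pdx w 1 t = 0 := fun t ht => by
    simp [hwx, hub t ht, hvb t ht]
  have hwt : ∀ x ∈ Icc (0:ℝ) 1, ∀ t ∈ Ici (0:ℝ), pdt w x t =
      cross3 (w x t) (pdx (pdx v) x t) + cross3 (u x t) (pdx (pdx w) x t) := fun x hx t ht => by
    have : pdt w x t = pdt v x t - pdt u x t :=
      ((hasDerivAt_pdt hvc x t).sub (hasDerivAt_pdt huc x t)).deriv
    rw [this, hut x hx t ht, hvt x hx t ht, hwxx, cross3_sub_right, hw, cross3_sub_left]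
    abel
  set z : ℝ → ℝ → E3 := fun x t => u x t - pdx (pdx v) x t with hz
  have hzc : ContDiff ℝ (⊤ : ℕ∞) fun p : ℝ × ℝ => z p.1 p.2 :=
    huc.sub (contDiff_pdx (contDiff_pdx hvc))
  have hzxc := contDiff_pdx hzc
  set ρ : ℝ → ℝ → ℝ := fun x t => ⟪w x t, w x t⟫ + ⟪pdx w x t, pdx w x t⟫ with hρ
  set ρ' : ℝ → ℝ → ℝ := fun x t =>
    2 * ⟪w x t, pdt w x t⟫ + 2 * ⟪pdx w x t, pdx (pdt w) x t⟫ with hρ'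
  have hρc : Continuous fun p : ℝ × ℝ => ρ p.1 p.2 :=
    (hwc.continuous.inner hwc.continuous).add (hwxc.continuous.inner hwxc.continuous)
  have hρ'c : Continuous fun p : ℝ × ℝ => ρ' p.1 p.2 :=
    ((hwc.continuous.inner hwtc.continuous).const_mul 2).add
      ((hwxc.continuous.inner (contDiff_pdx hwtc).continuous).const_mul 2)
  have hG : ∀ t, HasDerivAt (fun s => ∫ x in (0:ℝ)..1, ρ x s) (∫ x in (0:ℝ)..1, ρ' x t) t :=
    fun t => hasDerivAt_intervalIntegral_of_continuousOn isOpen_univ hρc.continuousOn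
      hρ'c.continuousOn (fun x s _ => by
        have h1 := hasDerivAt_pdt hwc x s
        have h2 := hasDerivAt_pdt hwxc x s
        rw [pdt_pdx hwc] at h2
        refine ((h1.inner ℝ h1).add (h2.inner ℝ h2)).congr_deriv ?_
        rw [real_inner_comm (w x s), real_inner_comm (pdx w x s)]
        simp only [hρ']
        ring) 0 1 (mem_univ t)
  have hcx : ∀ {E : Type} [TopologicalSpace E] {g : ℝ → ℝ → E} (t : ℝ),
      (Continuous fun p : ℝ × ℝ => g p.1 p.2) → Continuous fun x => g x t :=
    fun t hg => hg.comp (continuous_id.prodMk continuous_const)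
  have hG' : ∀ t ∈ Ici (0:ℝ), ∫ x in (0:ℝ)..1, ρ' x t =
      ∫ x in (0:ℝ)..1, -(2 * ⟪cross3 (w x t) (pdx z x t), pdx w x t⟫) := fun t ht => by
    have hkc : Continuous fun x => -(2 * ⟪cross3 (w x t) (pdx z x t), pdx w x t⟫) :=
      hcx (g := fun x t => -(2 * ⟪cross3 (w x t) (pdx z x t), pdx w x t⟫)) t
        ((((crossCLM.continuous.comp hwc.continuous).clm_apply hzxc.continuous).inner
          hwxc.continuous).const_mul 2).neg
    rw [← sub_eq_zero, ← intervalIntegral.integral_sub ((hcx t hρ'c).intervalIntegrable _ _)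
      (hkc.intervalIntegrable _ _),
      intervalIntegral.integral_eq_sub_of_hasDerivAt
        (f := fun x => 2 * ⟪pdx w x t, pdt w x t⟫ + 2 * ⟪cross3 (w x t) (z x t), pdx w x t⟫)]
    · simp [hwb t ht]
    · intro x hx
      rw [uIcc_of_le h01] at hx
      have h1 := hasDerivAt_pdx hwc x t
      have h2 := hasDerivAt_pdx hwxc x t
      have h3 := hasDerivAt_pdx hwtc x t
      have h4 := hasDerivAt_pdx hzc x t
      refine (((h2.inner ℝ h3).const_mul 2).add
        (((h1.cross3 h4).inner ℝ h2).const_mul 2)).congr_deriv ?_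
      simp only [hρ']
      rw [hwt x hx t ht]
      simp only [hz]
      generalize pdx (fun x t => u x t - pdx (pdx v) x t) x t = zx
      simp only [cross3_apply_zero, cross3_apply_one, cross3_apply_two, inner_E3, PiLp.add_apply,
        PiLp.sub_apply]
      ring
    · exact ((hcx t hρ'c).sub hkc).intervalIntegrable _ _
  have hρ0 : ∀ x t, 0 ≤ ρ x t := fun x t =>
    add_nonneg real_inner_self_nonneg real_inner_self_nonneg
  have hG0 : ∫ x in (0:ℝ)..1, ρ x 0 = 0 := by
    rw [intervalIntegral.integral_congr (g := fun _ => (0:ℝ)), intervalIntegral.integral_zero]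
    intro x hx
    rw [uIcc_of_le h01] at hx
    have hw0 : ∀ y ∈ Icc (0:ℝ) 1, w y 0 = 0 := fun y hy => sub_eq_zero.2 (h0 y hy)
    have hwx0 : pdx w x 0 = 0 := by
      have h1 := (hasDerivAt_pdx hwc x 0).hasDerivWithinAt (s := Icc 0 1)
      have h2 : HasDerivWithinAt (fun y => w y 0) 0 (Icc 0 1) x :=
        (hasDerivWithinAt_const x _ (0 : E3)).congr_of_mem hw0 hx
      exact (uniqueDiffOn_Icc zero_lt_one x hx).eq_deriv _ h1 h2
    simp [hρ, hw0 x hx, hwx0]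
  intro x hx T hT
  obtain ⟨M, hM⟩ := (isCompact_Icc.prod isCompact_Icc).exists_bound_of_continuousOn
    (s := Icc (0:ℝ) 1 ×ˢ Icc (0:ℝ) T) hzxc.continuous.continuousOn
  have hzero := eq_zero_of_abs_deriv_le_mul_abs_self_of_eq_zero_right
    (f := fun s => ∫ x in (0:ℝ)..1, ρ x s) (f' := fun t => ∫ x in (0:ℝ)..1, ρ' x t) (K := M)
    (a := 0) (b := T) (fun s _ => (hG s).continuousAt.continuousWithinAt)
    (fun s _ => (hG s).hasDerivWithinAt) hG0 (fun t ht => by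
      have hint : IntervalIntegrable (fun x => M * ρ x t) volume 0 1 :=
        ((hcx t hρc).const_mul M).intervalIntegrable _ _
      rw [Real.norm_of_nonneg (intervalIntegral.integral_nonneg h01 fun x _ => hρ0 x t),
        hG' t ht.1, ← intervalIntegral.integral_const_mul]
      refine intervalIntegral.norm_integral_le_of_norm_le h01 (ae_of_all _ fun y hy => ?_) hint
      have hzb : ‖pdx z y t‖ ≤ M := hM (y, t) ⟨⟨hy.1.le, hy.2⟩, ⟨ht.1, ht.2.le⟩⟩
      have h1 : |⟪cross3 (w y t) (pdx z y t), pdx w y t⟫| ≤ ‖w y t‖ * M * ‖pdx w y t‖ :=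
        (abs_real_inner_le_norm _ _).trans (by
          gcongr
          exact (norm_cross3_le _ _).trans (by gcongr))
      rw [norm_neg, norm_mul, Real.norm_eq_abs, Real.norm_eq_abs, abs_two]
      simp only [hρ, real_inner_self_eq_norm_sq]
      nlinarith [mul_nonneg ((norm_nonneg _).trans hzb) (sq_nonneg (‖w y t‖ - ‖pdx w y t‖))]) T
    ⟨hT, le_rfl⟩
  by_contra hne
  refine (intervalIntegral.integral_pos zero_lt_one (hcx T hρc).continuousOn
    (fun y _ => hρ0 y T) ⟨x, hx, ?_⟩).ne' hzero
  refine add_pos_of_pos_of_nonneg ?_ real_inner_self_nonneg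
  exact real_inner_self_pos.2 (sub_ne_zero.2 hne)

end Uniqueness

theorem global_existence_uniqueness_smooth_schrodinger_flow
    (u₀ : ℝ → E3) (hsm : ContDiff ℝ (⊤ : ℕ∞) u₀)
    (hsph : ∀ x ∈ Icc (0:ℝ) 1, ‖u₀ x‖ = 1)
    (hcc : ∀ k : ℕ, CC u₀ k) :
    ∃ u : ℝ → ℝ → E3,
      (IsGlobalSol u ∧ ∀ x ∈ Icc (0:ℝ) 1, u x 0 = u₀ x) ∧
      ∀ v : ℝ → ℝ → E3, (IsGlobalSol v ∧ ∀ x ∈ Icc (0:ℝ) 1, v x 0 = u₀ x) →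
        ∀ x ∈ Icc (0:ℝ) 1, ∀ t ∈ Ici (0:ℝ), v x t = u x t := by
  obtain ⟨u, hu, hu0⟩ := exists_isGlobalSol hsm hsph hcc
  exact ⟨u, ⟨hu, hu0⟩, fun v ⟨hv, hv0⟩ =>
    hu.eq_of_eq_zero_time hv fun x hx => (hv0 x hx).trans (hu0 x hx).symm⟩

end
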